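/- arXiv:1212.3898 — 2 statements merged into one kernel-verified Lean document; each statement's English description precedes it below -/
import Mathlib

section
/- If m is an even integer with m ≥ 2 and G is a finite simple graph with maximum degree Δ(G) = 3, and n is an integer with 1 < m < n, then χ(G^{m/n}) = (3m/2) + 1. -/
open SimpleGraph

/-- Representations of vertices of the `n`-subdivision of `G`: `(u, u, 0)` represents the
branch vertex `u`, and for an adjacent pair `(u, v)`, the triple `(u, v, i)` with `i ≤ n`
represents the point at distance `i` from `u` on the path of length `n` replacing the
edge `uv`. -/
def SubdivPre {V : Type*} (G : SimpleGraph V) (n : ℕ) : Type _ :=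
  {p : V × V × ℕ // (p.1 = p.2.1 ∧ p.2.2 = 0) ∨ (G.Adj p.1 p.2.1 ∧ p.2.2 ≤ n)}

/-- The identifications between representations: `(u, v, i)` and `(v, u, n - i)` represent
the same point, and `(u, v, 0)` represents the branch vertex `u`, i.e. `(u, u, 0)`. -/
inductive SubdivRel {V : Type*} (G : SimpleGraph V) (n : ℕ) :
    SubdivPre G n → SubdivPre G n → Prop
  | flip (u v : V) (i : ℕ) (h : G.Adj u v) (hi : i ≤ n) :
      SubdivRel G n ⟨(u, v, i), Or.inr ⟨h, hi⟩⟩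
        ⟨(v, u, n - i), Or.inr ⟨h.symm, Nat.sub_le n i⟩⟩
  | collapse (u v : V) (h : G.Adj u v) :
      SubdivRel G n ⟨(u, v, 0), Or.inr ⟨h, Nat.zero_le n⟩⟩ ⟨(u, u, 0), Or.inl ⟨rfl, rfl⟩⟩

/-- The vertex set of the `n`-subdivision of `G`. -/
def SubdivVert {V : Type*} (G : SimpleGraph V) (n : ℕ) : Type _ := Quot (SubdivRel G n)

/-- The branch vertex of the subdivision corresponding to a vertex `u` of `G`. -/
def branchVertex {V : Type*} (G : SimpleGraph V) (n : ℕ) (u : V) : SubdivVert G n :=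
  Quot.mk _ ⟨(u, u, 0), Or.inl ⟨rfl, rfl⟩⟩

/-- The vertex `(uv)_i` of the subdivision: the point at distance `i` from `u` on the
path of length `n` replacing the edge `uv`. -/
def mkVert {V : Type*} (G : SimpleGraph V) (n : ℕ) {u v : V} (h : G.Adj u v)
    (i : ℕ) (hi : i ≤ n) : SubdivVert G n :=
  Quot.mk _ ⟨(u, v, i), Or.inr ⟨h, hi⟩⟩

/-- The `n`-subdivision `G^{1/n}` of `G`: each edge of `G` is replaced by a path of
length `n`; consecutive points on such a path are adjacent. -/
def subdivision {V : Type*} (G : SimpleGraph V) (n : ℕ) : SimpleGraph (SubdivVert G n) :=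
  SimpleGraph.fromRel (fun x y => ∃ (u v : V) (h : G.Adj u v) (i : ℕ) (hi : i < n),
    x = mkVert G n h i (le_of_lt hi) ∧ y = mkVert G n h (i + 1) hi)

/-- The `m`-power of a graph: two distinct vertices are adjacent iff their distance is
at most `m`, i.e. iff there is a walk of length at most `m` between them. -/
def powerGraph {W : Type*} (H : SimpleGraph W) (m : ℕ) : SimpleGraph W :=
  SimpleGraph.fromRel (fun x y => ∃ w : H.Walk x y, w.length ≤ m)

/-- The fractional power `G^{m/n}`, the `m`-power of the `n`-subdivision of `G`. -/
def fracPower {V : Type*} (G : SimpleGraph V) (m n : ℕ) : SimpleGraph (SubdivVert G n) :=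
  powerGraph (subdivision G n) m


open SimpleGraph

/-! ## Part 1: the subdivision -/

section Part1

variable {V : Type*} {G : SimpleGraph V} {n : ℕ}

theorem mkVert_flip {u v : V} (h : G.Adj u v) (i : ℕ) (hi : i ≤ n) :
    mkVert G n h i hi = mkVert G n h.symm (n - i) (Nat.sub_le n i) :=
  Quot.sound (SubdivRel.flip u v i h hi)

theorem mkVert_zero {u v : V} (h : G.Adj u v) :
    mkVert G n h 0 (Nat.zero_le n) = branchVertex G n u :=
  Quot.sound (SubdivRel.collapse u v h)

open Classical in
/-- An invariant of points of the subdivision. -/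
noncomputable def subdivInv (hn : 0 < n) : SubdivVert G n → V ⊕ Sym2 (V × ℕ) :=
  Quot.lift (fun p => if p.1.2.2 = 0 then Sum.inl p.1.1
      else if p.1.2.2 = n then Sum.inl p.1.2.1
      else Sum.inr s((p.1.1, p.1.2.2), (p.1.2.1, n - p.1.2.2))) (by
    rintro _ _ (⟨u, v, i, h, hi⟩ | ⟨u, v, h⟩)
    · dsimp only
      by_cases h0 : i = 0
      · subst h0
        simp [hn.ne']
      · by_cases h1 : i = n
        · subst h1
          simp [hn.ne']
        · have h2 : n - i ≠ 0 := by omega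
          have h3 : n - i ≠ n := by omega
          have h4 : n - (n - i) = i := by omega
          simp only [h0, h1, h2, h3, h4, if_false]
          rw [Sym2.eq_swap]
    · simp)

theorem mkVert_eq_mid (hn : 0 < n) {u v a b : V} (h : G.Adj u v) (h' : G.Adj a b) {i t : ℕ}
    (hi : i ≤ n) (ht : t ≤ n) (hi0 : 0 < i) (hin : i < n)
    (he : mkVert G n h i hi = mkVert G n h' t ht) :
    (a = u ∧ b = v ∧ t = i) ∨ (a = v ∧ b = u ∧ t = n - i) := by
  have := congrArg (subdivInv hn) he
  simp only [subdivInv, mkVert] at this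
  rw [if_neg hi0.ne', if_neg hin.ne] at this
  split_ifs at this with h1 h2
  simp only [Sum.inr.injEq, Sym2.eq_iff, Prod.mk.injEq] at this
  rcases this with ⟨⟨rfl, rfl⟩, rfl, _⟩ | ⟨⟨rfl, h5⟩, rfl, h6⟩
  · left; exact ⟨rfl, rfl, rfl⟩
  · right; exact ⟨rfl, rfl, h6.symm⟩

theorem branch_eq (hn : 0 < n) {u a b : V} (h' : G.Adj a b) {t : ℕ}
    (ht : t ≤ n) (he : branchVertex G n u = mkVert G n h' t ht) :
    (t = 0 ∧ a = u) ∨ (t = n ∧ b = u) := by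
  have := congrArg (subdivInv hn) he
  simp only [subdivInv, mkVert, branchVertex] at this
  rw [if_pos trivial] at this
  split_ifs at this with h1 h2 <;> simp at this
  · left; exact ⟨h1, this.symm⟩
  · right; exact ⟨h2, this.symm⟩

theorem subdiv_adj {y z : SubdivVert G n} (h : (subdivision G n).Adj y z) :
    ∃ (a b : V) (hab : G.Adj a b) (t t' : ℕ) (ht : t ≤ n) (ht' : t' ≤ n),
      y = mkVert G n hab t ht ∧ z = mkVert G n hab t' ht' ∧ (t' = t + 1 ∨ t = t' + 1) := by
  rw [subdivision, SimpleGraph.fromRel_adj] at h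
  obtain ⟨_, ⟨u, v, h, i, hi, rfl, rfl⟩ | ⟨u, v, h, i, hi, rfl, rfl⟩⟩ := h
  · exact ⟨u, v, h, i, i + 1, hi.le, hi, rfl, rfl, Or.inl rfl⟩
  · exact ⟨u, v, h, i + 1, i, hi, hi.le, rfl, rfl, Or.inr rfl⟩

/-- Points at small distance: on one path, or on two paths at a common branch vertex. -/
def Near (G : SimpleGraph V) (n l : ℕ) (x y : SubdivVert G n) : Prop :=
  x = y ∨ (∃ (u v : V) (h : G.Adj u v) (i j : ℕ) (hi : i ≤ n) (hj : j ≤ n),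
      x = mkVert G n h i hi ∧ y = mkVert G n h j hj ∧ i ≤ j + l ∧ j ≤ i + l) ∨
    (∃ (u v v' : V) (h : G.Adj u v) (h' : G.Adj u v') (i j : ℕ) (hi : i ≤ n) (hj : j ≤ n),
      v ≠ v' ∧ x = mkVert G n h i hi ∧ y = mkVert G n h' j hj ∧ i + j ≤ l)

theorem mkVert_congr {u v : V} (h : G.Adj u v) {i j : ℕ} (e : i = j) (hi : i ≤ n) (hj : j ≤ n) :
    mkVert G n h i hi = mkVert G n h j hj := by subst e; rfl

/-- A step starting from level `0` at a branch vertex. -/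
theorem Near.branch_step {l : ℕ} {x z : SubdivVert G n} {u v : V} (h : G.Adj u v) {i : ℕ}
    (hi : i ≤ n) (hx : x = mkVert G n h i hi) (hil : i ≤ l) {a b : V} (hab : G.Adj a b) (hn : 1 ≤ n)
    (hau : a = u) (hz : z = mkVert G n hab 1 hn) : Near G n (l + 1) x z := by
  subst hau
  by_cases hvb : v = b
  · subst hvb
    exact Or.inr (Or.inl ⟨a, v, h, i, 1, hi, hn, hx, hz, by omega, by omega⟩)
  · exact Or.inr (Or.inr ⟨a, v, b, h, hab, i, 1, hi, hn, hvb, hx, hz, by omega⟩)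

theorem Near.branch_step' {l : ℕ} (hn : 0 < n) {x y z : SubdivVert G n} {u v : V} (h : G.Adj u v)
    {i : ℕ}
    (hi : i ≤ n) (hx : x = mkVert G n h i hi) (hil : i ≤ l) (hy : y = branchVertex G n u)
    (hyz : (subdivision G n).Adj y z) : Near G n (l + 1) x z := by
  obtain ⟨a, b, hab, t, t', ht, ht', h1, h2, h3⟩ := subdiv_adj hyz
  rcases branch_eq hn hab ht (hy.symm.trans h1) with ⟨rfl, rfl⟩ | ⟨rfl, rfl⟩
  · have : t' = 1 := by omega
    subst this
    exact Near.branch_step h hi hx hil hab hn rfl h2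
  · have : t' = t - 1 := by omega
    subst this
    refine Near.branch_step h hi hx hil hab.symm hn rfl (h2.trans ?_)
    rw [mkVert_flip]
    exact mkVert_congr _ (by omega) _ _

theorem Near.mid_step {y z : SubdivVert G n} (hn : 0 < n) {u v : V} (h : G.Adj u v) {j : ℕ}
    (hj : j ≤ n) (hy : y = mkVert G n h j hj) (hj0 : 0 < j) (hjn : j < n)
    (hyz : (subdivision G n).Adj y z) :
    ∃ (j' : ℕ) (hj' : j' ≤ n), z = mkVert G n h j' hj' ∧ (j' = j + 1 ∨ j = j' + 1) := by
  obtain ⟨a, b, hab, t, t', ht, ht', h1, h2, h3⟩ := subdiv_adj hyz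
  rcases mkVert_eq_mid hn h hab hj ht hj0 hjn (hy.symm.trans h1) with ⟨rfl, rfl, rfl⟩ | ⟨rfl, rfl, h5⟩
  · exact ⟨t', ht', h2, h3⟩
  · refine ⟨n - t', Nat.sub_le _ _, h2.trans (mkVert_flip _ _ _), by omega⟩

theorem Near.step {l : ℕ} {x y z : SubdivVert G n} (hxy : Near G n l x y) (hl : l + 1 < n)
    (hyz : (subdivision G n).Adj y z) : Near G n (l + 1) x z := by
  have hn : 0 < n := by omega
  rcases hxy with rfl | ⟨u, v, h, i, j, hi, hj, hx, hy, h1, h2⟩ |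
      ⟨u, v, v', h, h', i, j, hi, hj, hvv, hx, hy, h1⟩
  · obtain ⟨a, b, hab, t, t', ht, ht', h1, h2, h3⟩ := subdiv_adj hyz
    exact Or.inr (Or.inl ⟨a, b, hab, t, t', ht, ht', h1, h2, by omega, by omega⟩)
  · rcases Nat.eq_zero_or_pos j with rfl | hj0
    · exact Near.branch_step' hn h hi hx (by omega) (hy.trans (mkVert_zero h)) hyz
    · rcases hj.eq_or_lt with rfl | hjn
      · refine Near.branch_step' hn h.symm (Nat.sub_le _ i) (hx.trans (mkVert_flip _ _ _))
          (by omega) (hy.trans ?_) hyz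
        rw [mkVert_flip, ← mkVert_zero h.symm]
        exact mkVert_congr _ (by omega) _ _
      · obtain ⟨j', hj', hz, h3⟩ := Near.mid_step hn h hj hy hj0 hjn hyz
        exact Or.inr (Or.inl ⟨u, v, h, i, j', hi, hj', hx, hz, by omega, by omega⟩)
  · rcases Nat.eq_zero_or_pos j with rfl | hj0
    · exact Near.branch_step' hn h hi hx (by omega) (hy.trans (mkVert_zero h')) hyz
    · have hjn : j < n := by omega
      obtain ⟨j', hj', hz, h3⟩ := Near.mid_step hn h' hj hy hj0 hjn hyz
      exact Or.inr (Or.inr ⟨u, v, v', h, h', i, j', hi, hj', hvv, hx, hz, by omega⟩)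

theorem Near.mono {l l' : ℕ} (hl : l ≤ l') {x y : SubdivVert G n} (hxy : Near G n l x y) :
    Near G n l' x y := by
  rcases hxy with rfl | ⟨u, v, h, i, j, hi, hj, hx, hy, h1, h2⟩ |
      ⟨u, v, v', h, h', i, j, hi, hj, hvv, hx, hy, h1⟩
  · exact Or.inl rfl
  · exact Or.inr (Or.inl ⟨u, v, h, i, j, hi, hj, hx, hy, by omega, by omega⟩)
  · exact Or.inr (Or.inr ⟨u, v, v', h, h', i, j, hi, hj, hvv, hx, hy, by omega⟩)

theorem near_of_walk {x y : SubdivVert G n} (w : (subdivision G n).Walk x y) :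
    w.length < n → Near G n w.length x y := by
  induction w using SimpleGraph.Walk.concatRec with
  | Hnil => intro _; exact Or.inl rfl
  | Hconcat p h ih =>
    intro hl
    rw [SimpleGraph.Walk.length_concat] at hl ⊢
    exact Near.step (ih (by omega)) hl h

theorem near_of_adj {m : ℕ} (hmn : m < n) {x y : SubdivVert G n} (h : (fracPower G m n).Adj x y) :
    x ≠ y ∧ (Near G n m x y ∨ Near G n m y x) := by
  rw [fracPower, powerGraph, SimpleGraph.fromRel_adj] at h
  obtain ⟨hne, ⟨w, hw⟩ | ⟨w, hw⟩⟩ := h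
  · exact ⟨hne, Or.inl ((near_of_walk w (by omega)).mono hw)⟩
  · exact ⟨hne, Or.inr ((near_of_walk w (by omega)).mono hw)⟩

/-- From a labelling of the half edges to a colouring of the fractional power. -/
theorem colorable_of_P {K : Type*} {m : ℕ} (hmn : m < n) (C : Finset K) (c : V → K)
    (P : V → V → ℕ → K) (hc : ∀ u, c u ∈ C)
    (hP : ∀ u v, G.Adj u v → ∀ i ≤ n, P u v i ∈ C)
    (hflip : ∀ u v, G.Adj u v → ∀ i ≤ n, P u v i = P v u (n - i))
    (hzero : ∀ u v, G.Adj u v → P u v 0 = c u)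
    (hpath : ∀ u v, G.Adj u v → ∀ i j, i < j → j ≤ n → j ≤ i + m → P u v i ≠ P u v j)
    (hstar : ∀ u v v', G.Adj u v → G.Adj u v' → v ≠ v' → ∀ i j, 1 ≤ i → 1 ≤ j → i + j ≤ m →
      P u v i ≠ P u v' j) :
    (fracPower G m n).Colorable C.card := by
  classical
  let f : SubdivVert G n → K := Quot.lift
    (fun p => if G.Adj p.1.1 p.1.2.1 then P p.1.1 p.1.2.1 p.1.2.2 else c p.1.1) (by
    rintro _ _ (⟨u, v, i, h, hi⟩ | ⟨u, v, h⟩)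
    · simp only [h, h.symm, if_true]; exact hflip u v h i hi
    · simp [h, hzero u v h])
  have hf : ∀ {u v : V} (h : G.Adj u v) (i : ℕ) (hi : i ≤ n), f (mkVert G n h i hi) = P u v i := by
    intro u v h i hi
    simp [f, mkVert, h]
  have hfC : ∀ x, f x ∈ C := by
    rintro ⟨⟨⟨u, v, i⟩, h | h⟩⟩
    · change (if G.Adj u v then P u v i else c u) ∈ C
      obtain ⟨h1, h2⟩ := h
      dsimp only at h1 h2
      subst h1
      simp [hc]
    · change (if G.Adj u v then P u v i else c u) ∈ C
      rw [if_pos h.1]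
      exact hP u v h.1 i h.2
  have hnear : ∀ x y, x ≠ y → Near G n m x y → f x ≠ f y := by
    intro x y hne hxy
    rcases hxy with rfl | ⟨u, v, h, i, j, hi, hj, rfl, rfl, h1, h2⟩ |
      ⟨u, v, v', h, h', i, j, hi, hj, hvv, rfl, rfl, h1⟩
    · exact absurd rfl hne
    · rw [hf, hf]
      rcases lt_trichotomy i j with h3 | rfl | h3
      · exact hpath u v h i j h3 hj h2
      · exact absurd rfl hne
      · exact (hpath u v h j i h3 hi h1).symm
    · rw [hf, hf]
      rcases Nat.eq_zero_or_pos i with rfl | hi0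
      · rw [hzero u v h, ← hzero u v' h']
        rcases Nat.eq_zero_or_pos j with rfl | hj0
        · exact absurd ((mkVert_zero h).trans (mkVert_zero h').symm) hne
        · exact hpath u v' h' 0 j hj0 hj (by omega)
      · rcases Nat.eq_zero_or_pos j with rfl | hj0
        · rw [hzero u v' h', ← hzero u v h]
          exact (hpath u v h 0 i hi0 hi (by omega)).symm
        · exact hstar u v v' h h' hvv i j hi0 hj0 h1
  have col : (fracPower G m n).Coloring C := SimpleGraph.Coloring.mk (fun x => ⟨f x, hfC x⟩) (by
    intro x y hxy heq
    obtain ⟨hne, h | h⟩ := near_of_adj hmn hxy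
    · exact hnear x y hne h (congrArg Subtype.val heq)
    · exact hnear y x hne.symm h (congrArg Subtype.val heq).symm)
  have := col.colorable
  rwa [Fintype.card_coe] at this

theorem walk_branch {u v : V} (h : G.Adj u v) (i : ℕ) (hi : i ≤ n) :
    ∃ w : (subdivision G n).Walk (branchVertex G n u) (mkVert G n h i hi), w.length ≤ i := by
  induction i with
  | zero => rw [mkVert_zero]; exact ⟨SimpleGraph.Walk.nil, le_rfl⟩
  | succ i ih =>
    obtain ⟨w, hw⟩ := ih (by omega)
    by_cases he : mkVert G n h i (by omega) = mkVert G n h (i + 1) hi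
    · rw [← he]; exact ⟨w, by omega⟩
    · have hadj : (subdivision G n).Adj (mkVert G n h i (by omega)) (mkVert G n h (i + 1) hi) := by
        rw [subdivision, SimpleGraph.fromRel_adj]
        exact ⟨he, Or.inl ⟨u, v, h, i, hi, rfl, rfl⟩⟩
      exact ⟨w.concat hadj, by rw [SimpleGraph.Walk.length_concat]; omega⟩

theorem lower_bound [Fintype V] [DecidableRel G.Adj] {k : ℕ} (hmn : 2 * k < n) (u : V)
    (hu : G.degree u = 3) {N : ℕ} (hN : (fracPower G (2 * k) n).Colorable N) : 3 * k + 1 ≤ N := by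
  classical
  obtain ⟨col⟩ := hN
  have hn : 0 < n := by omega
  let pt : Option (G.neighborFinset u × Fin k) → SubdivVert G n := fun o => match o with
    | none => branchVertex G n u
    | some (v, i) => mkVert G n ((G.mem_neighborFinset u v.1).1 v.2) (i.1 + 1) (by omega)
  have hw : ∀ o, ∃ w : (subdivision G n).Walk (branchVertex G n u) (pt o), w.length ≤ k := by
    rintro (_ | ⟨v, i⟩)
    · exact ⟨SimpleGraph.Walk.nil, by simp⟩
    · obtain ⟨w, hw⟩ := walk_branch ((G.mem_neighborFinset u v.1).1 v.2) (i.1 + 1)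
        (show i.1 + 1 ≤ n by omega)
      exact ⟨w, by omega⟩
  have hinj : Function.Injective pt := by
    rintro (_ | ⟨v, i⟩) (_ | ⟨v', i'⟩) he
    · rfl
    · exfalso
      rcases branch_eq hn _ _ he with h | h <;> omega
    · exfalso
      rcases branch_eq hn _ _ he.symm with h | h <;> omega
    · have hi := i.2
      rcases mkVert_eq_mid hn _ _ _ _ (by omega) (by omega) he with ⟨h1, h2, h3⟩ | ⟨h1, h2, h3⟩
      · have : v = v' := Subtype.ext h2.symm
        have h4 : i = i' := Fin.ext (by omega)
        rw [this, h4]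
      · exfalso
        have := i'.2
        omega
  have hcol : Function.Injective (fun o => col (pt o)) := by
    intro o o' he
    by_contra hne
    refine col.valid ?_ he
    rw [fracPower, powerGraph, SimpleGraph.fromRel_adj]
    refine ⟨fun h => hne (hinj h), Or.inl ?_⟩
    obtain ⟨w, hw1⟩ := hw o
    obtain ⟨w', hw2⟩ := hw o'
    exact ⟨w.reverse.append w', by
      rw [SimpleGraph.Walk.length_append, SimpleGraph.Walk.length_reverse]; omega⟩
  have := Fintype.card_le_of_injective _ hcol
  rw [Fintype.card_option, Fintype.card_prod, Fintype.card_coe, G.card_neighborFinset_eq_degree,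
    hu, Fintype.card_fin, Fintype.card_fin] at this
  exact this

end Part1

open SimpleGraph

/-! ## Part 2: words along the edges -/

section Part2

variable {V K : Type*} {G : SimpleGraph V}

/-- A word of length `n` along the edge `uv` which is compatible with the data `A`. -/
structure EdgeOK (G : SimpleGraph V) (C : Finset K) (A : V → V → ℕ → K) (k n : ℕ) (u v : V)
    (p : ℕ → K) : Prop where
  mem : ∀ i ≤ n, p i ∈ C
  path : ∀ i j, i < j → j ≤ n → j ≤ i + 2 * k → p i ≠ p j
  left : ∀ i ≤ k, p i = A u v i
  right : ∀ i ≤ k, p (n - i) = A v u i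
  starL : ∀ v', G.Adj u v' → v' ≠ v → ∀ i j, k < i → 1 ≤ j → i + j ≤ 2 * k → p i ≠ A u v' j
  starR : ∀ u', G.Adj v u' → u' ≠ u → ∀ i j, k < i → 1 ≤ j → i + j ≤ 2 * k → p (n - i) ≠ A v u' j

/-- The middle part of the shortest word. -/
structure MidOK (G : SimpleGraph V) (C : Finset K) (A : V → V → ℕ → K) (k r : ℕ) (u v : V)
    (M : ℕ → K) : Prop where
  mem : ∀ a, 1 ≤ a → a ≤ r → M a ∈ C
  inj : ∀ a b, 1 ≤ a → a < b → b ≤ r → M a ≠ M b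
  left : ∀ a i, 1 ≤ a → a ≤ r → i ≤ k → a ≤ k + i → M a ≠ A u v i
  right : ∀ a j, 1 ≤ a → a ≤ r → j ≤ k → r + 1 ≤ a + k + j → M a ≠ A v u j
  starL : ∀ v', G.Adj u v' → v' ≠ v → ∀ a j, 1 ≤ a → a ≤ r → 1 ≤ j → a + j ≤ k → M a ≠ A u v' j
  starR : ∀ u', G.Adj v u' → u' ≠ u → ∀ a j, 1 ≤ a → a ≤ r → 1 ≤ j → r + 1 + j ≤ a + k →
    M a ≠ A v u' j

theorem EdgeOK.reverse {C : Finset K} {A : V → V → ℕ → K} {k n : ℕ} {u v : V} {p : ℕ → K}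
    (hn : 2 * k < n) (h : EdgeOK G C A k n u v p) : EdgeOK G C A k n v u (fun i => p (n - i)) where
  mem i _ := h.mem _ (Nat.sub_le _ _)
  path i j hij hj hk := (h.path (n - j) (n - i) (by omega) (by omega) (by omega)).symm
  left i hi := h.right i hi
  right i hi := by
    have : n - (n - i) = i := by omega
    rw [this]; exact h.left i hi
  starL u' h1 h2 i j hi hj hij := h.starR u' h1 h2 i j hi hj hij
  starR v' h1 h2 i j hi hj hij := by
    have : n - (n - i) = i := by omega
    rw [this]; exact h.starL v' h1 h2 i j hi hj hij

theorem EdgeOK.extend {C : Finset K} {A : V → V → ℕ → K} {k n : ℕ} {u v : V} {p : ℕ → K}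
    (hn : 2 * k < n) (h : EdgeOK G C A k n u v p) :
    EdgeOK G C A k (n + (2 * k + 1)) u v (fun i => if i ≤ 2 * k then p i else p (i - (2 * k + 1)))
    where
  mem i hi := by
    split_ifs
    · exact h.mem _ (by omega)
    · exact h.mem _ (by omega)
  path i j hij hj hk := by
    split_ifs with h1 h2 h2
    · exact h.path i j hij (by omega) hk
    · exact (h.path (j - (2 * k + 1)) i (by omega) (by omega) (by omega)).symm
    · omega
    · exact h.path _ _ (by omega) (by omega) (by omega)
  left i hi := by
    rw [if_pos (by omega)]; exact h.left i hi
  right i hi := by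
    rw [if_neg (by omega)]
    have : n + (2 * k + 1) - i - (2 * k + 1) = n - i := by omega
    rw [this]; exact h.right i hi
  starL v' h1 h2 i j hi hj hij := by
    rw [if_pos (by omega)]; exact h.starL v' h1 h2 i j hi hj hij
  starR u' h1 h2 i j hi hj hij := by
    rw [if_neg (by omega)]
    have : n + (2 * k + 1) - i - (2 * k + 1) = n - i := by omega
    rw [this]; exact h.starR u' h1 h2 i j hi hj hij

theorem EdgeOK.base {C : Finset K} {A : V → V → ℕ → K} {k r : ℕ} {u v : V} {M : ℕ → K}
    (huv : G.Adj u v)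
    (hA : ∀ u v, G.Adj u v → ∀ i ≤ k, A u v i ∈ C)
    (hinj : ∀ u v, G.Adj u v → ∀ i j, i < j → j ≤ k → A u v i ≠ A u v j)
    (h3 : ∀ u v, G.Adj u v → ∀ i j, i ≤ k → j ≤ k → r + 1 ≤ i + j → A u v i ≠ A v u j)
    (h4 : ∀ u v v', G.Adj u v → G.Adj u v' → v' ≠ v → ∀ i j, 1 ≤ j → i ≤ k → j + r + 1 ≤ i →
      A v u i ≠ A u v' j)
    (h : MidOK G C A k r u v M) :
    EdgeOK G C A k (2 * k + 1 + r) u v (fun i => if i ≤ k then A u v i else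
      if i ≤ k + r then M (i - k) else A v u (2 * k + 1 + r - i)) where
  mem i hi := by
    split_ifs with h1 h2
    · exact hA u v huv i h1
    · exact h.mem _ (by omega) (by omega)
    · exact hA v u huv.symm _ (by omega)
  path i j hij hj hk := by
    split_ifs with h1 h2 h5 h6 h7 h8 h9 <;> try omega
    · exact hinj u v huv i j hij h2
    · exact (h.left _ i (by omega) (by omega) h1 (by omega)).symm
    · exact h3 u v huv _ _ h1 (by omega) (by omega)
    · exact h.inj _ _ (by omega) (by omega) (by omega)
    · exact h.right _ _ (by omega) (by omega) (by omega) (by omega)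
    · exact (hinj v u huv.symm _ _ (by omega) (by omega)).symm
  left i hi := by rw [if_pos hi]
  right i hi := by
    rw [if_neg (by omega), if_neg (by omega)]
    congr 1; omega
  starL v' h1 h2 i j hi hj hij := by
    rw [if_neg (by omega)]
    split_ifs with h5
    · exact h.starL v' h1 h2 _ j (by omega) (by omega) hj (by omega)
    · exact h4 u v v' huv h1 h2 _ j hj (by omega) (by omega)
  starR u' h1 h2 i j hi hj hij := by
    split_ifs with h5 h6
    · exact h4 v u u' huv.symm h1 h2 _ j hj (by omega) (by omega)
    · exact h.starR u' h1 h2 _ j (by omega) (by omega) hj (by omega)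
    · omega

theorem colorable_of_A [Fintype V] {C : Finset K} {c : V → K} {A : V → V → ℕ → K} {k r : ℕ}
    (hc : ∀ u, c u ∈ C)
    (hc0 : ∀ u v, G.Adj u v → A u v 0 = c u)
    (hA : ∀ u v, G.Adj u v → ∀ i ≤ k, A u v i ∈ C)
    (hinj : ∀ u v, G.Adj u v → ∀ i j, i < j → j ≤ k → A u v i ≠ A u v j)
    (hstar : ∀ u v v', G.Adj u v → G.Adj u v' → v ≠ v' → ∀ i j, 1 ≤ i → 1 ≤ j → i ≤ k → j ≤ k →
      A u v i ≠ A u v' j)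
    (h3 : ∀ u v, G.Adj u v → ∀ i j, i ≤ k → j ≤ k → r + 1 ≤ i + j → A u v i ≠ A v u j)
    (h4 : ∀ u v v', G.Adj u v → G.Adj u v' → v' ≠ v → ∀ i j, 1 ≤ j → i ≤ k → j + r + 1 ≤ i →
      A v u i ≠ A u v' j)
    (hM : ∀ u v, G.Adj u v → (∃ M, MidOK G C A k r u v M) ∨ (∃ M, MidOK G C A k r v u M)) (N : ℕ) :
    (fracPower G (2 * k) (2 * k + 1 + r + N * (2 * k + 1))).Colorable C.card := by
  classical
  have key : ∀ u v, G.Adj u v →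
      ∃ p, EdgeOK G C A k (2 * k + 1 + r + N * (2 * k + 1)) u v p := by
    intro u v huv
    induction N with
    | zero =>
      simp only [zero_mul, add_zero]
      rcases hM u v huv with ⟨M, h⟩ | ⟨M, h⟩
      · exact ⟨_, EdgeOK.base huv hA hinj h3 h4 h⟩
      · exact ⟨_, (EdgeOK.base huv.symm hA hinj h3 h4 h).reverse (by omega)⟩
    | succ N ih =>
      obtain ⟨p, hp⟩ := ih
      have e : 2 * k + 1 + r + (N + 1) * (2 * k + 1)
          = 2 * k + 1 + r + N * (2 * k + 1) + (2 * k + 1) := by ring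
      rw [e]
      exact ⟨_, hp.extend (by omega)⟩
  generalize hn' : 2 * k + 1 + r + N * (2 * k + 1) = n at *
  have hn : 2 * k < n := by omega
  let q : V → V → ℕ → K := fun u v => if h : G.Adj u v then (key u v h).choose else fun _ => c u
  have hq : ∀ u v, G.Adj u v → EdgeOK G C A k n u v (q u v) := by
    intro u v h
    simp only [q, dif_pos h]
    exact (key u v h).choose_spec
  let f := Fintype.equivFin V
  let P : V → V → ℕ → K := fun u v => if f u < f v then q u v else fun i => q v u (n - i)
  have hP : ∀ u v, G.Adj u v → EdgeOK G C A k n u v (P u v) := by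
    intro u v h
    simp only [P]
    split_ifs
    · exact hq u v h
    · exact (hq v u h.symm).reverse hn
  refine colorable_of_P hn C c P hc (fun u v h i hi => (hP u v h).mem i hi) ?_ ?_
    (fun u v h i j hij hj hk => (hP u v h).path i j hij hj hk) ?_
  · intro u v h i hi
    have hne : f u ≠ f v := fun e => h.ne (f.injective e)
    simp only [P]
    rcases lt_or_gt_of_ne hne with h1 | h1
    · rw [if_pos h1, if_neg (not_lt.2 h1.le)]
      congr 1; omega
    · rw [if_pos h1, if_neg (not_lt.2 h1.le)]
  · intro u v h
    rw [(hP u v h).left 0 (Nat.zero_le _), hc0 u v h]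
  · intro u v v' h h' hne i j hi hj hij
    by_cases hik : i ≤ k
    · by_cases hjk : j ≤ k
      · rw [(hP u v h).left i hik, (hP u v' h').left j hjk]
        exact hstar u v v' h h' hne i j hi hj hik hjk
      · rw [(hP u v h).left i hik]
        exact ((hP u v' h').starL v h hne j i (by omega) hi (by omega)).symm
    · rw [(hP u v' h').left j (by omega)]
      exact (hP u v h).starL v' h' hne.symm i j (by omega) hj hij

end Part2

open SimpleGraph

/-! ## Part 3: structure lemmas for graphs of maximum degree at most three -/

section Part3

variable {V : Type*} {G : SimpleGraph V}

/-- All degrees are at most three. -/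
def DegLe3 (G : SimpleGraph V) : Prop :=
  ∀ (v : V) (S : Finset V), (∀ y ∈ S, G.Adj v y) → S.card ≤ 3

/-- A labelling of half edges is injective at every vertex. -/
def HalfInj {κ : Type*} (G : SimpleGraph V) (h : V → V → κ) : Prop :=
  ∀ u v v', G.Adj u v → G.Adj u v' → h u v = h u v' → v = v'

theorem exists_argmin {α : Type*} (Q : α → Prop) (f : α → ℕ) (hQ : ∃ x, Q x) :
    ∃ x, Q x ∧ ∀ y, Q y → f x ≤ f y := by
  classical
  have hex : ∃ t, ∃ x, Q x ∧ f x = t := by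
    obtain ⟨x, hx⟩ := hQ
    exact ⟨f x, x, hx, rfl⟩
  obtain ⟨x, hx, he⟩ := Nat.find_spec hex
  refine ⟨x, hx, fun y hy => ?_⟩
  rw [he]
  exact Nat.find_min' hex ⟨y, hy, rfl⟩

theorem exists_halfInj [Fintype V] (hG : DegLe3 G) : ∃ h : V → V → Fin 3, HalfInj G h := by
  classical
  have key : ∀ u, ∃ f : V → Fin 3, ∀ v v', G.Adj u v → G.Adj u v' → f v = f v' → v = v' := by
    intro u
    let S : Finset V := Finset.univ.filter (fun v => G.Adj u v)
    have hS : S.card ≤ 3 := hG u S (by simp [S])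
    have hS' : Fintype.card S ≤ Fintype.card (Fin 3) := by simpa using hS
    obtain ⟨e⟩ := Function.Embedding.nonempty_of_card_le hS'
    refine ⟨fun v => if h : v ∈ S then e ⟨v, h⟩ else 0, ?_⟩
    intro v v' hv hv' he
    have h1 : v ∈ S := by simp [S, hv]
    have h2 : v' ∈ S := by simp [S, hv']
    simp only [dif_pos h1, dif_pos h2] at he
    exact congrArg Subtype.val (e.injective he)
  choose h hh using key
  exact ⟨h, hh⟩

/-! ### (S4) proper colouring -/

theorem exists_proper4 [Fintype V] (hG : DegLe3 G) :
    ∃ c : V → Fin 4, ∀ u v, G.Adj u v → c u ≠ c v := by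
  classical
  let mono : (V → Fin 4) → Finset (V × V) := fun c =>
    Finset.univ.filter (fun p => G.Adj p.1 p.2 ∧ c p.1 = c p.2)
  obtain ⟨c, _, hmin⟩ := exists_argmin (fun _ : V → Fin 4 => True) (fun c => (mono c).card)
    ⟨fun _ => 0, trivial⟩
  refine ⟨c, fun u v huv he => ?_⟩
  let S : Finset V := Finset.univ.filter (fun v => G.Adj u v)
  have hS : S.card ≤ 3 := hG u S (by simp [S])
  obtain ⟨b, hb⟩ : ∃ b : Fin 4, b ∉ S.image c := by
    by_contra hcon
    push Not at hcon
    have h1 : (Finset.univ : Finset (Fin 4)) ⊆ S.image c := fun b _ => hcon b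
    have h2 := Finset.card_le_card h1
    have h3 : (S.image c).card ≤ S.card := Finset.card_image_le
    simp at h2
    omega
  have hb' : ∀ y, G.Adj u y → c y ≠ b := by
    intro y hy hc
    exact hb (Finset.mem_image.2 ⟨y, by simp [S, hy], hc⟩)
  have hss : mono (Function.update c u b) ⊂ mono c := by
    rw [Finset.ssubset_iff_of_subset]
    · refine ⟨(u, v), by simp [mono, huv, he], ?_⟩
      simp only [mono, Finset.mem_filter, Finset.mem_univ, true_and, not_and]
      intro _ h2
      rw [Function.update_self, Function.update_of_ne huv.ne'] at h2
      exact hb' v huv h2.symm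
    · rintro ⟨x, y⟩ hxy
      simp only [mono, Finset.mem_filter, Finset.mem_univ, true_and] at hxy ⊢
      obtain ⟨h1, h2⟩ := hxy
      refine ⟨h1, ?_⟩
      by_cases hx : x = u
      · subst hx
        rw [Function.update_self, Function.update_of_ne h1.ne'] at h2
        exact absurd h2.symm (hb' y h1)
      · by_cases hy : y = u
        · subst hy
          rw [Function.update_self, Function.update_of_ne hx] at h2
          exact absurd h2 (hb' x h1.symm)
        · rwa [Function.update_of_ne hx, Function.update_of_ne hy] at h2
  have := Finset.card_lt_card hss
  have h2 := hmin (Function.update c u b) trivial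
  omega

/-! ### (S1) half edge labellings -/

/-- Valid half edge labellings avoiding the vertex colours. -/
def OValid (G : SimpleGraph V) (c : V → Fin 4) (o : V → V → Fin 4) : Prop :=
  HalfInj G o ∧ ∀ u v, G.Adj u v → o u v ≠ c u

open Classical in
/-- Bad ordered pairs. -/
noncomputable def badSet [Fintype V] (G : SimpleGraph V) (o : V → V → Fin 4) : Finset (V × V) :=
  Finset.univ.filter (fun p => G.Adj p.1 p.2 ∧ o p.1 p.2 = o p.2 p.1)

theorem mem_badSet [Fintype V] {o : V → V → Fin 4} {u v : V} :
    (u, v) ∈ badSet G o ↔ G.Adj u v ∧ o u v = o v u := by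
  simp [badSet]

open Classical in
/-- Swap the labels of the half edges `yp` and `yw` at `y`. -/
noncomputable def oSwap {κ : Type*} (o : V → V → κ) (y p w : V) : V → V → κ :=
  Function.update o y (fun z => if z = p then o y w else if z = w then o y p else o y z)

theorem oSwap_ne {κ : Type*} (o : V → V → κ) {y p w x : V} (hx : x ≠ y) :
    oSwap o y p w x = o x := by
  simp [oSwap, hx]

theorem oSwap_p {κ : Type*} (o : V → V → κ) {y p w : V} :
    oSwap o y p w y p = o y w := by
  simp [oSwap]

theorem oSwap_w {κ : Type*} (o : V → V → κ) {y p w : V} (h : w ≠ p) :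
    oSwap o y p w y w = o y p := by
  simp [oSwap, h]

theorem oSwap_other {κ : Type*} (o : V → V → κ) {y p w z : V} (h : z ≠ p) (h' : z ≠ w) :
    oSwap o y p w y z = o y z := by
  simp [oSwap, h, h']

theorem oSwap_valid {c : V → Fin 4} {o : V → V → Fin 4} (ho : OValid G c o) {y p w : V}
    (hp : G.Adj y p) (hw : G.Adj y w) (hwp : w ≠ p) : OValid G c (oSwap o y p w) := by
  constructor
  · intro u v v' h h' he
    by_cases hu : u = y
    · subst hu
      have hi := ho.1 u
      by_cases h1 : v = p
      · by_cases h2 : v' = p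
        · rw [h1, h2]
        · exfalso
          subst h1
          rw [oSwap_p] at he
          by_cases h3 : v' = w
          · subst h3
            rw [oSwap_w o h2] at he
            exact h2 (hi _ _ h' h he)
          · rw [oSwap_other o h2 h3] at he
            exact h3 (hi _ _ h' hw he.symm)
      · by_cases h2 : v' = p
        · exfalso
          subst h2
          rw [oSwap_p] at he
          by_cases h3 : v = w
          · subst h3
            rw [oSwap_w o h1] at he
            exact h1 (hi _ _ h h' he.symm)
          · rw [oSwap_other o h1 h3] at he
            exact h3 (hi _ _ h hw he)
        · by_cases h3 : v = w
          · by_cases h4 : v' = w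
            · rw [h3, h4]
            · subst h3
              rw [oSwap_w o h1, oSwap_other o h2 h4] at he
              exact absurd (hi _ _ h' hp he.symm) h2
          · by_cases h4 : v' = w
            · subst h4
              rw [oSwap_w o h2, oSwap_other o h1 h3] at he
              exact absurd (hi _ _ h hp he) h1
            · rw [oSwap_other o h1 h3, oSwap_other o h2 h4] at he
              exact hi _ _ h h' he
    · rw [oSwap_ne o hu] at he
      exact ho.1 u v v' h h' he
  · intro u v h
    by_cases hu : u = y
    · subst hu
      by_cases h1 : v = p
      · subst h1; rw [oSwap_p]; exact ho.2 _ _ hw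
      · by_cases h2 : v = w
        · subst h2; rw [oSwap_w o h1]; exact ho.2 _ _ hp
        · rw [oSwap_other o h1 h2]; exact ho.2 _ _ h
    · rw [oSwap_ne o hu]; exact ho.2 _ _ h

theorem oSwap_bad [Fintype V] [DecidableEq V] {o : V → V → Fin 4} {y p w : V}
    (hw : G.Adj y w) (hwp : w ≠ p) (ho : HalfInj G o) (hp : G.Adj y p) (hbad : o y p = o p y) :
    badSet G (oSwap o y p w) ⊆
      ((badSet G o).erase (y, p)).erase (p, y) ∪ (if o w y = o y p then {(y, w), (w, y)} else ∅) := by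
  rintro ⟨a, b⟩ hab
  rw [mem_badSet] at hab
  obtain ⟨h1, h2⟩ := hab
  have hyw : o y w ≠ o y p := fun e => hwp (ho _ _ _ hw hp e)
  simp only [Finset.mem_union, Finset.mem_erase, mem_badSet, ne_eq, Prod.mk.injEq]
  by_cases ha : a = y
  · subst ha
    rw [oSwap_ne o h1.ne'] at h2
    by_cases hb : b = p
    · subst hb
      rw [oSwap_p] at h2
      exact absurd (h2.trans hbad.symm) hyw
    · by_cases hb' : b = w
      · subst hb'
        rw [oSwap_w o hb] at h2
        right; rw [if_pos h2.symm]; simp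
      · rw [oSwap_other o hb hb'] at h2
        left
        exact ⟨fun e => h1.ne e.2.symm, fun e => hb e.2, h1, h2⟩
  · rw [oSwap_ne o ha] at h2
    by_cases hb : b = y
    · subst hb
      by_cases hap : a = p
      · subst hap
        rw [oSwap_p] at h2
        exact absurd (h2.symm.trans hbad.symm) hyw
      · by_cases haw : a = w
        · subst haw
          rw [oSwap_w o hap] at h2
          right; rw [if_pos h2]; simp
        · rw [oSwap_other o hap haw] at h2
          left
          exact ⟨fun e => hap e.1, fun e => ha e.1, h1, h2⟩
    · rw [oSwap_ne o hb] at h2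
      left
      exact ⟨fun e => hb e.2, fun e => ha e.1, h1, h2⟩

theorem exists_o [Fintype V] (hG : DegLe3 G) (c : V → Fin 4) :
    ∃ o : V → V → Fin 4, OValid G c o ∧ ∀ u v, G.Adj u v → o u v ≠ o v u := by
  classical
  obtain ⟨h, hh⟩ := exists_halfInj hG
  obtain ⟨o₀, ho₀, hmin⟩ := exists_argmin (OValid G c) (fun o => (badSet G o).card)
    ⟨fun u v => (c u).succAbove (h u v), by
      constructor
      · intro u v v' h1 h2 he
        exact hh u v v' h1 h2 (Fin.succAbove_right_injective he)
      · intro u v _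
        exact Fin.succAbove_ne _ _⟩
  refine ⟨o₀, ho₀, fun u₀ v₀ huv₀ he₀ => ?_⟩
  set a := o₀ u₀ v₀ with ha
  have key : ∀ j : ℕ, ∃ (o : V → V → Fin 4) (D : Finset V) (y p : V), OValid G c o ∧
      (badSet G o).card ≤ (badSet G o₀).card ∧ D.card = j + 1 ∧ y ∉ D ∧ p ∈ D ∧ G.Adj y p ∧
      o y p = a ∧ o p y = a ∧ ∀ x ∈ D, x ≠ p → ∃ z ∈ D, G.Adj x z ∧ o x z = a := by
    intro j
    induction j with
    | zero =>
      refine ⟨o₀, {u₀}, v₀, u₀, ho₀, le_rfl, by simp, by simpa using huv₀.ne', by simp,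
        huv₀.symm, he₀.symm, rfl, ?_⟩
      intro x hx hne
      exact absurd (Finset.mem_singleton.1 hx) hne
    | succ j ih =>
      obtain ⟨o, D, y, p, ho, hle, hcard, hyD, hpD, hyp, h1, h2, h3⟩ := ih
      have hbad : (y, p) ∈ badSet G o := mem_badSet.2 ⟨hyp, h1.trans h2.symm⟩
      have hbad' : (p, y) ∈ badSet G o := mem_badSet.2 ⟨hyp.symm, h2.trans h1.symm⟩
      have hne1 : (p, y) ≠ (y, p) := fun e => hyp.ne (congrArg Prod.snd e)
      have hc1 : (((badSet G o).erase (y, p)).erase (p, y)).card + 2 = (badSet G o).card := by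
        have e1 := Finset.card_erase_add_one hbad
        have e2 := Finset.card_erase_add_one (Finset.mem_erase.2 ⟨hne1, hbad'⟩)
        omega
      by_cases hw : ∃ w, G.Adj y w ∧ w ≠ p
      · obtain ⟨w, hyw, hwp⟩ := hw
        have hsub := Finset.card_le_card
          (oSwap_bad (o := o) hyw hwp ho.1 hyp (h1.trans h2.symm))
        have hval := oSwap_valid ho hyp hyw hwp
        have hm := hmin _ hval
        have hun := hsub.trans (Finset.card_union_le _ _)
        by_cases hwa : o w y = o y p
        · rw [if_pos hwa] at hun
          have hpair : ({(y, w), (w, y)} : Finset (V × V)).card ≤ 2 := Finset.card_le_two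
          have hwD : w ∉ D := by
            intro hwD
            obtain ⟨z, hz, hwz, hz'⟩ := h3 w hwD hwp
            have := ho.1 w z y hwz hyw.symm (by rw [hz', hwa, h1])
            exact hyD (this ▸ hz)
          have hwy : w ≠ y := hyw.ne'
          refine ⟨oSwap o y p w, insert y D, w, y, hval, by omega,
            by rw [Finset.card_insert_of_notMem hyD, hcard], ?_, Finset.mem_insert_self _ _,
            hyw.symm, ?_, ?_, ?_⟩
          · rw [Finset.mem_insert]; rintro (e | e)
            · exact hwy e
            · exact hwD e
          · rw [oSwap_ne o hwy, hwa, h1]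
          · rw [oSwap_w o hwp, h1]
          · intro x hx hxy
            have hxD : x ∈ D := (Finset.mem_insert.1 hx).resolve_left hxy
            rw [oSwap_ne o hxy]
            by_cases hxp : x = p
            · subst hxp
              exact ⟨y, Finset.mem_insert_self _ _, hyp.symm, h2⟩
            · obtain ⟨z, hz, hz'⟩ := h3 x hxD hxp
              exact ⟨z, Finset.mem_insert_of_mem hz, hz'⟩
        · exfalso
          rw [if_neg hwa, Finset.card_empty] at hun
          omega
      · exfalso
        push Not at hw
        obtain ⟨b, hb1, hb2⟩ : ∃ b : Fin 4, b ≠ c y ∧ b ≠ a :=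
          (by decide : ∀ d e : Fin 4, ∃ b : Fin 4, b ≠ d ∧ b ≠ e) (c y) a
        let o' : V → V → Fin 4 := Function.update o y (fun _ => b)
        have hoy : ∀ z, o' y z = b := fun z => by simp [o']
        have hox : ∀ x, x ≠ y → o' x = o x := fun x hx => by simp [o', hx]
        have hval : OValid G c o' := by
          constructor
          · intro u v v' hv hv' he
            by_cases hu : u = y
            · subst hu
              rw [hw v hv, hw v' hv']
            · rw [hox u hu] at he
              exact ho.1 u v v' hv hv' he
          · intro u v hv
            by_cases hu : u = y
            · subst hu; rw [hoy]; exact hb1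
            · rw [hox u hu]; exact ho.2 u v hv
        have hm := hmin _ hval
        have hsub : badSet G o' ⊆ ((badSet G o).erase (y, p)).erase (p, y) := by
          rintro ⟨x, z⟩ hxz
          rw [mem_badSet] at hxz
          obtain ⟨e1, e2⟩ := hxz
          simp only [Finset.mem_erase, mem_badSet, ne_eq, Prod.mk.injEq]
          by_cases hx : x = y
          · subst hx
            have := hw z e1
            subst this
            rw [hoy, hox z e1.ne', h2] at e2
            exact absurd e2 hb2
          · by_cases hz : z = y
            · subst hz
              have := hw x e1.symm
              subst this
              rw [hoy, hox x hx, h2] at e2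
              exact absurd e2.symm hb2
            · rw [hox x hx, hox z hz] at e2
              exact ⟨fun e => hz e.2, fun e => hx e.1, e1, e2⟩
        have := Finset.card_le_card hsub
        omega
  obtain ⟨o, D, y, p, _, _, hcard, _⟩ := key (Fintype.card V)
  have := Finset.card_le_univ D
  omega

end Part3

open SimpleGraph

section Part4

variable {V : Type*} {G : SimpleGraph V}

/-! ### (S2) orientations without monochromatic directed cycles -/

/-- The edges of class `w`, oriented. -/
def Edg (G : SimpleGraph V) (h : V → V → Fin 3) (w : Fin 3) (u v : V) : Prop :=
  G.Adj u v ∧ h u v = w + 1 ∧ h v u = w + 2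

/-- Valid labellings by three labels. -/
def HValid (G : SimpleGraph V) (h : V → V → Fin 3) : Prop :=
  HalfInj G h ∧ ∀ u v, G.Adj u v → h u v ≠ h v u

open Classical in
/-- The vertices on monochromatic directed cycles. -/
noncomputable def cycSet [Fintype V] (G : SimpleGraph V) (h : V → V → Fin 3) :
    Finset (Fin 3 × V) :=
  Finset.univ.filter (fun p => Relation.TransGen (Edg G h p.1) p.2 p.2)

theorem mem_cycSet [Fintype V] {h : V → V → Fin 3} {w : Fin 3} {v : V} :
    (w, v) ∈ cycSet G h ↔ Relation.TransGen (Edg G h w) v v := by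
  simp [cycSet]

theorem cycle_transfer {E E' : V → V → Prop} {v : V}
    (hE : ∀ a b, a ≠ v → b ≠ v → E' a b → E a b) (hv : ¬ Relation.TransGen E' v v) {x : V}
    (hx : Relation.TransGen E' x x) : Relation.TransGen E x x := by
  have hne : ∀ z, Relation.TransGen E' z z → z ≠ v := by
    rintro z hz rfl; exact hv hz
  have key : ∀ y, Relation.TransGen E' x y → Relation.TransGen E' y x →
      Relation.TransGen E x y := by
    intro y hxy
    induction hxy with
    | single h => intro hyx; exact .single (hE _ _ (hne _ hx) (hne _ (hyx.tail h)) h)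
    | tail hxb hbc ih =>
      intro hcx
      have hbx := Relation.TransGen.head hbc hcx
      exact (ih hbx).tail (hE _ _ (hne _ (hbx.trans hxb)) (hne _ (hcx.trans (hxb.tail hbc))) hbc)
  exact key x hx hx

theorem fin3_add (w : Fin 3) : w ≠ w + 1 ∧ w ≠ w + 2 ∧ w + 1 ≠ w + 2 ∧ w + 1 + 1 = w + 2 ∧
    w + 1 + 2 = w ∧ w + 2 + 1 = w ∧ w + 2 + 2 = w + 1 := by
  revert w; decide

theorem fin3_swap (w : Fin 3) : (∀ z : Fin 3, Equiv.swap w (w + 1) z = w → z = w + 1) ∧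
    (∀ z : Fin 3, Equiv.swap w (w + 1) z = w + 1 → z = w) ∧
    (∀ z : Fin 3, Equiv.swap w (w + 1) z = w + 2 → z = w + 2) := by
  revert w; decide

theorem fin3_cases (w z : Fin 3) : z = w ∨ z = w + 1 ∨ z = w + 2 := by
  revert w z; decide

theorem cyc_step [Fintype V] {h : V → V → Fin 3} (hh : HValid G h) {w : Fin 3} {v : V}
    (hv : Relation.TransGen (Edg G h w) v v)
    (hx : ∀ x, G.Adj v x → h v x = w → h x v = w + 2) :
    ∃ h', HValid G h' ∧ (cycSet G h').card < (cycSet G h).card := by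
  classical
  obtain ⟨w1, w2, w3, w4, w5, w6, w7⟩ := fin3_add w
  obtain ⟨sw1, sw2, sw3⟩ := fin3_swap w
  obtain ⟨hinj, hne⟩ := hh
  -- the out-neighbour and the in-neighbour
  obtain ⟨v', hv', -⟩ := Relation.TransGen.head'_iff.1 hv
  obtain ⟨v'', -, hv''⟩ := Relation.TransGen.tail'_iff.1 hv
  obtain ⟨a1, a2, a3⟩ := hv'
  obtain ⟨b1, b2, b3⟩ := hv''
  have out : ∀ z, G.Adj v z → h v z = w + 1 → h z v = w + 2 := by
    intro z hz e
    have := hinj v z v' hz a1 (e.trans a2.symm)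
    rw [this]; exact a3
  have inn : ∀ z, G.Adj v z → h v z = w + 2 → h z v = w + 1 := by
    intro z hz e
    have := hinj v z v'' hz b1.symm (e.trans b3.symm)
    rw [this]; exact b2
  let h' : V → V → Fin 3 := Function.update h v (fun z => Equiv.swap w (w + 1) (h v z))
  have hv1 : ∀ z, h' v z = Equiv.swap w (w + 1) (h v z) := fun z => by simp [h']
  have hv2 : ∀ x, x ≠ v → h' x = h x := fun x hx => by simp [h', hx]
  have hval : HValid G h' := by
    constructor
    · intro x y z hy hz he
      by_cases hxv : x = v
      · subst hxv
        rw [hv1, hv1] at he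
        exact hinj _ _ _ hy hz ((Equiv.swap w (w + 1)).injective he)
      · rw [hv2 x hxv] at he
        exact hinj _ _ _ hy hz he
    · have main : ∀ z, G.Adj v z → h' v z ≠ h' z v := by
        intro z hz he
        rw [hv1, hv2 z hz.ne'] at he
        rcases fin3_cases w (h v z) with e | e | e
        · rw [hx z hz e, e, Equiv.swap_apply_left] at he
          exact w3 he
        · rw [out z hz e, e, Equiv.swap_apply_right] at he
          exact w2 he
        · rw [inn z hz e] at he
          rw [sw2 _ he] at e
          exact w2 e
      intro x y hxy he
      by_cases hxv : x = v
      · subst hxv; exact main y hxy he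
      · by_cases hyv : y = v
        · subst hyv; exact main x hxy.symm he.symm
        · rw [hv2 x hxv, hv2 y hyv] at he
          exact hne x y hxy he
  have hoff : ∀ w' a b, a ≠ v → b ≠ v → Edg G h' w' a b → Edg G h w' a b := by
    intro w' a b ha hb hab
    unfold Edg at hab ⊢
    rwa [hv2 a ha, hv2 b hb] at hab
  -- `v` is on no cycle any more
  have hno : ∀ w', ¬ Relation.TransGen (Edg G h' w') v v := by
    intro w' hcyc
    rcases fin3_cases w w' with rfl | rfl | rfl
    · have key : ∀ y, Relation.TransGen (Edg G h' w') v y →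
          ¬ Relation.TransGen (Edg G h w') v y := by
        intro y hy
        induction hy with
        | @single y hvy =>
          intro hcon
          obtain ⟨e1, e2, e3⟩ := hvy
          rw [hv1] at e2
          have e2' := sw2 _ e2
          rw [hv2 y e1.ne'] at e3
          obtain ⟨u, -, hu⟩ := Relation.TransGen.tail'_iff.1 hcon
          obtain ⟨f1, f2, f3⟩ := hu
          have : u = v := hinj y u v f1.symm e1.symm (f3.trans e3.symm)
          subst this
          rw [e2'] at f2
          exact w1 f2
        | @tail b d hb hbd ih =>
          intro hcon
          have hbv : b ≠ v := by
            rintro rfl; exact ih hv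
          have hbd' : Edg G h w' b d := by
            by_cases hdv : d = v
            · subst hdv
              obtain ⟨e1, e2, e3⟩ := hbd
              rw [hv2 b hbv] at e2
              rw [hv1] at e3
              exact ⟨e1, e2, sw3 _ e3⟩
            · exact hoff _ _ _ hbv hdv hbd
          obtain ⟨u, hu1, hu⟩ := Relation.TransGen.tail'_iff.1 hcon
          have : u = b := hinj d u b hu.1.symm hbd'.1.symm (hu.2.2.trans hbd'.2.2.symm)
          subst this
          rcases Relation.reflTransGen_iff_eq_or_transGen.1 hu1 with e | e
          · exact hbv e
          · exact ih e
      exact key v hcyc hv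
    · obtain ⟨z, ⟨e1, e2, e3⟩, -⟩ := Relation.TransGen.head'_iff.1 hcyc
      rw [hv1, w4] at e2
      rw [hv2 z e1.ne', w5, inn z e1 (sw3 _ e2)] at e3
      exact w1 e3.symm
    · obtain ⟨z, ⟨e1, e2, e3⟩, -⟩ := Relation.TransGen.head'_iff.1 hcyc
      rw [hv1, w6] at e2
      rw [hv2 z e1.ne', w7, out z e1 (sw1 _ e2)] at e3
      exact w3 e3.symm
  refine ⟨h', hval, Finset.card_lt_card ?_⟩
  rw [Finset.ssubset_iff_of_subset]
  · exact ⟨(w, v), mem_cycSet.2 hv, fun hc => hno w (mem_cycSet.1 hc)⟩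
  · rintro ⟨w', x⟩ hx'
    rw [mem_cycSet] at hx' ⊢
    exact cycle_transfer (hoff w') (hno w') hx'

theorem edg_neg {h : V → V → Fin 3} {w : Fin 3} {u v : V} :
    Edg G (fun u v => - h u v) w u v ↔ Edg G h (-w) v u := by
  unfold Edg
  have e : ∀ a w : Fin 3, (-a = w + 1 ↔ a = -w + 2) ∧ (-a = w + 2 ↔ a = -w + 1) := by decide
  rw [(e _ _).1, (e _ _).2, G.adj_comm]
  tauto

theorem hValid_neg {h : V → V → Fin 3} (hh : HValid G h) : HValid G (fun u v => - h u v) :=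
  ⟨fun u v v' h1 h2 e => hh.1 u v v' h1 h2 (neg_injective e),
    fun u v h1 e => hh.2 u v h1 (neg_injective e)⟩

theorem transGen_neg {h : V → V → Fin 3} {w : Fin 3} {u v : V} :
    Relation.TransGen (Edg G (fun u v => - h u v) w) u v ↔ Relation.TransGen (Edg G h (-w)) v u := by
  rw [← Relation.transGen_swap]
  have : Function.swap (Edg G (fun u v => - h u v) w) = Edg G h (-w) := by
    funext a b
    exact propext edg_neg
  rw [this]

theorem cycSet_neg_card [Fintype V] {h : V → V → Fin 3} :
    (cycSet G (fun u v => - h u v)).card ≤ (cycSet G h).card := by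
  refine Finset.card_le_card_of_injOn (fun p => (-p.1, p.2)) ?_ ?_
  · rintro ⟨w, v⟩ hp
    have := transGen_neg.1 (mem_cycSet.1 (Finset.mem_coe.1 hp))
    exact Finset.mem_coe.2 (mem_cycSet.2 this)
  · rintro ⟨w, v⟩ _ ⟨w', v'⟩ _ e
    simp only [Prod.mk.injEq, neg_inj] at e
    rw [e.1, e.2]

theorem exists_h [Fintype V] (hG : DegLe3 G) :
    ∃ h : V → V → Fin 3, HValid G h ∧ ∀ w v, ¬ Relation.TransGen (Edg G h w) v v := by
  classical
  obtain ⟨o, ho, ho'⟩ := exists_o hG (fun _ => 0)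
  let h₀ : V → V → Fin 3 := fun u v => if e : o u v ≠ 0 then (o u v).pred e else 0
  have hval₀ : HValid G h₀ := by
    constructor
    · intro u v v' h1 h2 e
      simp only [h₀, dif_pos (ho.2 u v h1), dif_pos (ho.2 u v' h2)] at e
      exact ho.1 u v v' h1 h2 (Fin.pred_inj.1 e)
    · intro u v h1 e
      simp only [h₀, dif_pos (ho.2 u v h1), dif_pos (ho.2 v u h1.symm)] at e
      exact ho' u v h1 (Fin.pred_inj.1 e)
  obtain ⟨h, hval, hmin⟩ := exists_argmin (HValid G) (fun h => (cycSet G h).card) ⟨h₀, hval₀⟩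
  refine ⟨h, hval, fun w v hcyc => ?_⟩
  by_cases hx : ∀ x, G.Adj v x → h v x = w → h x v = w + 2
  · obtain ⟨h', hv', hlt⟩ := cyc_step hval hcyc hx
    have := hmin h' hv'
    omega
  · push Not at hx
    obtain ⟨x, hx1, hx2, hx3⟩ := hx
    have hx4 : h x v = w + 1 := by
      rcases fin3_cases w (h x v) with e | e | e
      · exact absurd (hx2.trans e.symm) (hval.2 v x hx1)
      · exact e
      · exact absurd e hx3
    have hcyc' : Relation.TransGen (Edg G (fun u v => - h u v) (-w)) v v := by
      rw [transGen_neg, neg_neg]; exact hcyc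
    obtain ⟨h', hv', hlt⟩ := cyc_step (hValid_neg hval) hcyc' (by
      intro y hy hyw
      have e := hval.1 v y x hy hx1 ((neg_injective hyw).trans hx2.symm)
      rw [e, hx4]
      exact (by decide : ∀ w : Fin 3, -(w + 1) = -w + 2) w)
    have := hmin h' hv'
    have h2 := cycSet_neg_card (G := G) (h := h)
    omega

theorem wf_union [Fintype V] {h : V → V → Fin 3} (hval : HValid G h)
    (hac : ∀ w v, ¬ Relation.TransGen (Edg G h w) v v) (s : Fin 3) :
    WellFounded (fun u v => Edg G h (s + 2) u v ∨ Edg G h s u v) := by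
  obtain ⟨w1, w2, w3, w4, w5, w6, w7⟩ := fin3_add s
  have hno : ∀ u v z, Edg G h (s + 2) u v → ¬ Edg G h s v z := by
    rintro u v z ⟨e1, e2, e3⟩ ⟨f1, f2, f3⟩
    have : u = z := hval.1 v u z e1.symm f1 (by rw [e3, f2, w7])
    subst this
    rw [f3, w6] at e2
    exact w2 e2.symm
  have key : ∀ x y, Relation.TransGen (fun u v => Edg G h (s + 2) u v ∨ Edg G h s u v) x y →
      Relation.TransGen (Edg G h s) x y ∨ Relation.TransGen (Edg G h (s + 2)) x y ∨
      ∃ z, Relation.TransGen (Edg G h s) x z ∧ Relation.TransGen (Edg G h (s + 2)) z y := by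
    intro x y hxy
    induction hxy with
    | single e =>
      rcases e with e | e
      · exact Or.inr (Or.inl (.single e))
      · exact Or.inl (.single e)
    | tail hb e ih =>
      rcases e with e | e
      · rcases ih with h1 | h1 | ⟨z, h1, h2⟩
        · exact Or.inr (Or.inr ⟨_, h1, .single e⟩)
        · exact Or.inr (Or.inl (h1.tail e))
        · exact Or.inr (Or.inr ⟨z, h1, h2.tail e⟩)
      · rcases ih with h1 | h1 | ⟨z, h1, h2⟩
        · exact Or.inl (h1.tail e)
        · obtain ⟨_, _, e'⟩ := Relation.TransGen.tail'_iff.1 h1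
          exact absurd e (hno _ _ _ e')
        · obtain ⟨_, _, e'⟩ := Relation.TransGen.tail'_iff.1 h2
          exact absurd e (hno _ _ _ e')
  have hirr : ∀ x, ¬ Relation.TransGen (fun u v => Edg G h (s + 2) u v ∨ Edg G h s u v) x x := by
    intro x hx
    rcases key x x hx with h1 | h1 | ⟨z, h1, h2⟩
    · exact hac _ _ h1
    · exact hac _ _ h1
    · obtain ⟨_, _, e'⟩ := Relation.TransGen.tail'_iff.1 h2
      obtain ⟨_, e'', _⟩ := Relation.TransGen.head'_iff.1 h1
      exact hno _ _ _ e' e''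
  have hwf : WellFounded
      (Relation.TransGen (fun u v => Edg G h (s + 2) u v ∨ Edg G h s u v)) := by
    have : Std.Irrefl (Relation.TransGen (fun u v => Edg G h (s + 2) u v ∨ Edg G h s u v)) :=
      ⟨hirr⟩
    exact Finite.wellFounded_of_trans_of_irrefl _
  refine Subrelation.wf (r := Relation.TransGen _) ?_ hwf
  intro a b e
  exact Relation.TransGen.single e

/-! ### (S3) choosing orders along an acyclic relation -/

theorem dag_choice {X : Type*} [Nonempty X] {A B : V → V → Prop}
    (hwf : WellFounded (fun u v => A u v ∨ B u v))
    (hA : ∀ u u' v, A u v → A u' v → u = u') (hB : ∀ u u' v, B u v → B u' v → u = u')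
    (PA PB : X → X → Prop) (hstep : ∀ x1 x2, ∃ y, PA x1 y ∧ PB x2 y) :
    ∃ Λ : V → X, (∀ u v, A u v → PA (Λ u) (Λ v)) ∧ (∀ u v, B u v → PB (Λ u) (Λ v)) := by
  classical
  choose st hst1 hst2 using hstep
  let F : (v : V) → ((u : V) → (A u v ∨ B u v) → X) → X := fun v f =>
    st (if h : ∃ u, A u v then f h.choose (Or.inl h.choose_spec) else Classical.arbitrary X)
      (if h : ∃ u, B u v then f h.choose (Or.inr h.choose_spec) else Classical.arbitrary X)
  refine ⟨hwf.fix F, ?_, ?_⟩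
  · intro u v huv
    have h : ∃ u, A u v := ⟨u, huv⟩
    have e : h.choose = u := hA _ _ _ h.choose_spec huv
    have e2 : ∃ x2, hwf.fix F v = st (hwf.fix F u) x2 :=
      ⟨_, (hwf.fix_eq F v).trans ((congrArg (fun z => st z _) (dif_pos h)).trans
        (congrArg (fun z => st (hwf.fix F z) _) e))⟩
    obtain ⟨x2, e2⟩ := e2
    rw [e2]
    exact hst1 _ _
  · intro u v huv
    have h : ∃ u, B u v := ⟨u, huv⟩
    have e : h.choose = u := hB _ _ _ h.choose_spec huv
    have e2 : ∃ x1, hwf.fix F v = st x1 (hwf.fix F u) :=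
      ⟨_, (hwf.fix_eq F v).trans ((congrArg (fun z => st _ z) (dif_pos h)).trans
        (congrArg (fun z => st _ (hwf.fix F z)) e))⟩
    obtain ⟨x1, e2⟩ := e2
    rw [e2]
    exact hst2 _ _

/-! ### (S5) cuts -/

theorem exists_cut [Fintype V] [DecidableEq V] (W : V → V → ℕ) (hs : ∀ x y, W x y = W y x)
    (h0 : ∀ x, W x x = 0) :
    ∃ b : V → Bool, ∀ v, ∑ y, (if b v = b y then W v y else 0) ≤
      ∑ y, (if b v = b y then 0 else W v y) := by
  let F : (V → Bool) → ℕ := fun b => ∑ x, ∑ y, if b x = b y then W x y else 0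
  obtain ⟨b, _, hmin⟩ := exists_argmin (fun _ => True) F ⟨fun _ => true, trivial⟩
  refine ⟨b, fun v => ?_⟩
  let S := Finset.univ.erase v
  let T : (V → Bool) → ℕ := fun b => ∑ x ∈ S, ∑ y ∈ S, if b x = b y then W x y else 0
  have hF : ∀ b, F b = T b + 2 * ∑ y ∈ S, (if b v = b y then W v y else 0) := by
    intro b
    have h1 : ∀ g : V → ℕ, ∑ x, g x = g v + ∑ x ∈ S, g x := fun g =>
      (Finset.add_sum_erase Finset.univ g (Finset.mem_univ v)).symm
    simp only [F, T]
    rw [h1, h1, Finset.sum_congr rfl (fun x _ => h1 _), Finset.sum_add_distrib]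
    have h2 : ∑ x ∈ S, (if b x = b v then W x v else 0) =
        ∑ y ∈ S, (if b v = b y then W v y else 0) := by
      refine Finset.sum_congr rfl (fun x _ => ?_)
      rw [hs x v]
      simp only [eq_comm]
    rw [h2, h0]
    simp only [if_true]
    ring
  have hT : T (Function.update b v (!b v)) = T b := by
    refine Finset.sum_congr rfl (fun x hx => Finset.sum_congr rfl (fun y hy => ?_))
    rw [Function.update_of_ne (Finset.ne_of_mem_erase hx),
      Function.update_of_ne (Finset.ne_of_mem_erase hy)]
  have hb := hmin (Function.update b v (!b v)) trivial
  rw [hF, hF, hT] at hb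
  have h3 : ∑ y ∈ S, (if Function.update b v (!b v) v = Function.update b v (!b v) y then W v y else 0)
      = ∑ y ∈ S, (if b v = b y then 0 else W v y) := by
    refine Finset.sum_congr rfl (fun y hy => ?_)
    rw [Function.update_self, Function.update_of_ne (Finset.ne_of_mem_erase hy)]
    cases b v <;> cases b y <;> simp
  rw [h3] at hb
  rw [← Finset.add_sum_erase Finset.univ _ (Finset.mem_univ v),
    ← Finset.add_sum_erase Finset.univ (fun y => if b v = b y then 0 else W v y)
      (Finset.mem_univ v), h0]
  simp only [if_true]
  change 0 + ∑ y ∈ S, _ ≤ 0 + ∑ y ∈ S, _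
  omega

theorem exists_bits [Fintype V] (hG : DegLe3 G) :
    ∃ (h : V → V → Fin 3) (b : V → Fin 3 → Bool), HalfInj G h ∧
      ∀ u v, G.Adj u v → b u (h u v) ≠ b v (h u v) := by
  classical
  obtain ⟨h0, hh0⟩ := exists_halfInj hG
  let W1 : V → V → ℕ := fun x y => if G.Adj x y then 1 else 0
  obtain ⟨b1, hb1⟩ := exists_cut W1 (fun x y => by simp [W1, G.adj_comm]) (fun x => by simp [W1])
  let W2 : V → V → ℕ := fun x y => if G.Adj x y then (if b1 x = b1 y then 3 else 1) else 0
  obtain ⟨b2, hb2⟩ := exists_cut W2 (fun x y => by simp [W2, G.adj_comm, eq_comm])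
    (fun x => by simp [W2])
  have key : ∀ v, (∃ y, G.Adj v y) → ∃ y0, G.Adj v y0 ∧ b2 v ≠ b2 y0 ∧
      ∀ y, G.Adj v y → y ≠ y0 → b1 v ≠ b1 y := by
    intro v ⟨z, hz⟩
    let S : Finset V := Finset.univ.filter (fun y => G.Adj v y)
    have hS : S.card ≤ 3 := hG v S (by simp [S])
    have hb1v := hb1 v
    have hb2v := hb2 v
    have e1 : ∀ g : V → ℕ, (∀ y, ¬ G.Adj v y → g y = 0) → ∑ y, g y = ∑ y ∈ S, g y := by
      intro g hg
      symm
      refine Finset.sum_subset (Finset.subset_univ _) (fun y _ hy => hg y ?_)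
      simpa [S] using hy
    have f1 : ∑ y, (if b1 v = b1 y then W1 v y else 0) =
        (S.filter (fun y => b1 v = b1 y)).card := by
      rw [e1 _ (fun y hy => by simp [W1, hy]), Finset.card_filter]
      refine Finset.sum_congr rfl (fun y hy => ?_)
      have : G.Adj v y := by simpa [S] using hy
      simp [W1, this]
    have f2 : ∑ y, (if b1 v = b1 y then 0 else W1 v y) =
        (S.filter (fun y => ¬ b1 v = b1 y)).card := by
      rw [e1 _ (fun y hy => by simp [W1, hy]), Finset.card_filter]
      refine Finset.sum_congr rfl (fun y hy => ?_)
      have : G.Adj v y := by simpa [S] using hy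
      simp [W1, this]
    rw [f1, f2] at hb1v
    have f3 := Finset.card_filter_add_card_filter_not (s := S) (fun y => b1 v = b1 y)
    have hle1 : (S.filter (fun y => b1 v = b1 y)).card ≤ 1 := by omega
    by_cases hy0 : ∃ y0, G.Adj v y0 ∧ b1 v = b1 y0
    · obtain ⟨y0, h1, h2⟩ := hy0
      have huniq : ∀ y, G.Adj v y → y ≠ y0 → b1 v ≠ b1 y := by
        intro y hy hne he
        refine hne (Finset.card_le_one.1 hle1 y ?_ y0 ?_)
        · simp [S, hy, he]
        · simp [S, h1, h2]
      refine ⟨y0, h1, fun he => ?_, huniq⟩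
      have g1 : 3 ≤ ∑ y, (if b2 v = b2 y then W2 v y else 0) := by
        refine le_trans ?_ (Finset.single_le_sum (f := fun y => if b2 v = b2 y then W2 v y else 0)
          (fun _ _ => Nat.zero_le _) (Finset.mem_univ y0))
        simp [W2, he, h1, h2]
      have hy0S : y0 ∈ S := by simp [S, h1]
      have g2 : ∑ y, (if b2 v = b2 y then 0 else W2 v y) ≤ 2 := by
        rw [e1 _ (fun y hy => by simp [W2, hy]), ← Finset.add_sum_erase S _ hy0S, if_pos he,
          zero_add]
        have hc : (S.erase y0).card ≤ 2 := by
          rw [Finset.card_erase_of_mem hy0S]; omega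
        refine le_trans (Finset.sum_le_card_nsmul _ _ 1 (fun y hy => ?_)) (by simpa using hc)
        have hy1 := Finset.ne_of_mem_erase hy
        have hy2 : G.Adj v y := by simpa [S] using Finset.mem_of_mem_erase hy
        have := huniq y hy2 hy1
        simp only [W2, hy2, if_true, this, if_false]
        split_ifs <;> simp
      omega
    · push Not at hy0
      by_contra hcon
      push Not at hcon
      have hall : ∀ y, G.Adj v y → b2 v = b2 y := by
        intro y hy
        by_contra hne
        obtain ⟨y', h1, _, h3⟩ := hcon y hy hne
        exact hy0 y' h1 h3
      have g1 : 1 ≤ ∑ y, (if b2 v = b2 y then W2 v y else 0) := by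
        refine le_trans ?_ (Finset.single_le_sum (f := fun y => if b2 v = b2 y then W2 v y else 0)
          (fun _ _ => Nat.zero_le _) (Finset.mem_univ z))
        simp only [W2, hz, hall z hz, if_true]
        split_ifs <;> simp
      have g2 : ∑ y, (if b2 v = b2 y then 0 else W2 v y) = 0 := by
        refine Finset.sum_eq_zero (fun y _ => ?_)
        by_cases hy : G.Adj v y
        · simp [hall y hy]
        · simp [W2, hy]
      omega
  have key2 : ∀ v, ∃ f : V → Fin 3, (∀ y y', G.Adj v y → G.Adj v y' → f y = f y' → y = y') ∧
      ∀ y, G.Adj v y → (f y = 1 → b2 v ≠ b2 y) ∧ (f y ≠ 1 → b1 v ≠ b1 y) := by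
    intro v
    by_cases hv : ∃ y, G.Adj v y
    · obtain ⟨y0, h1, h2, h3⟩ := key v hv
      refine ⟨fun y => Equiv.swap (h0 v y0) 1 (h0 v y), ?_, ?_⟩
      · intro y y' hy hy' e
        exact hh0 v y y' hy hy' ((Equiv.swap _ _).injective e)
      · intro y hy
        constructor
        · intro e
          have : h0 v y = h0 v y0 := by
            apply (Equiv.swap (h0 v y0) 1).injective
            rw [Equiv.swap_apply_left]; exact e
          rw [hh0 v y y0 hy h1 this]; exact h2
        · intro e
          refine h3 y hy ?_
          rintro rfl
          exact e (Equiv.swap_apply_left _ _)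
    · push Not at hv
      exact ⟨fun _ => 0, fun y _ hy => absurd hy (hv y), fun y hy => absurd hy (hv y)⟩
  choose h hh using key2
  refine ⟨h, fun v s => if s = 1 then b2 v else b1 v, fun u v v' h1 h2 e => (hh u).1 v v' h1 h2 e, ?_⟩
  intro u v huv
  obtain ⟨e1, e2⟩ := (hh u).2 v huv
  by_cases hs : h u v = 1
  · simp only [hs, if_true]; exact e1 hs
  · simp only [hs, if_false]; exact e2 hs

end Part4

open SimpleGraph

/-! ## Part 5: the first regime, `r ≤ k` -/

section Part5

variable {V : Type*} {G : SimpleGraph V}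

/-- Colours: letters of three types, and four special colours. -/
abbrev Col := (Fin 3 × ℕ) ⊕ Fin 4

theorem edg_or {h : V → V → Fin 3} (hh : HValid G h) {u v : V} (huv : G.Adj u v) :
    (∃ w, Edg G h w u v) ∨ (∃ w, Edg G h w v u) := by
  have key : ∀ a b : Fin 3, a ≠ b → (∃ w : Fin 3, a = w + 1 ∧ b = w + 2) ∨
      (∃ w : Fin 3, b = w + 1 ∧ a = w + 2) := by decide
  rcases key _ _ (hh.2 u v huv) with ⟨w, h1, h2⟩ | ⟨w, h1, h2⟩
  · exact Or.inl ⟨w, huv, h1, h2⟩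
  · exact Or.inr ⟨w, huv.symm, h1, h2⟩

/-- The set of colours. -/
def colSet (T : Finset ℕ) (S : Finset (Fin 4)) : Finset Col :=
  (Finset.univ ×ˢ T).disjSum S

theorem colSet_card (T : Finset ℕ) (S : Finset (Fin 4)) :
    (colSet T S).card = 3 * T.card + S.card := by
  simp [colSet, Finset.card_product]

theorem inl_mem_colSet {T : Finset ℕ} {S : Finset (Fin 4)} {s : Fin 3} {l : ℕ} :
    (Sum.inl (s, l) : Col) ∈ colSet T S ↔ l ∈ T := by
  simp [colSet]

theorem inr_mem_colSet {T : Finset ℕ} {S : Finset (Fin 4)} {s : Fin 4} :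
    (Sum.inr s : Col) ∈ colSet T S ↔ s ∈ S := by
  simp [colSet]

theorem inl_ne {s s' : Fin 3} {l l' : ℕ} (h : s = s' → l = l' → False) :
    (Sum.inl (s, l) : Col) ≠ Sum.inl (s', l') := by
  intro e
  simp only [Sum.inl.injEq, Prod.mk.injEq] at e
  exact h e.1 e.2

/-- Choose orders of the letters for all vertices and types. -/
theorem exists_orders [Fintype V] {h : V → V → Fin 3} (hval : HValid G h)
    (hac : ∀ w v, ¬ Relation.TransGen (Edg G h w) v v) {X : Type*} [Nonempty X]
    (PA PB : X → X → Prop) (hstep : ∀ x1 x2, ∃ y, PA x1 y ∧ PB x2 y) :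
    ∃ L : V → Fin 3 → X, (∀ w u v, Edg G h w u v → PA (L u (w + 1)) (L v (w + 1))) ∧
      (∀ w u v, Edg G h w u v → PB (L u w) (L v w)) := by
  have key : ∀ s : Fin 3, ∃ Λ : V → X, (∀ u v, Edg G h (s + 2) u v → PA (Λ u) (Λ v)) ∧
      (∀ u v, Edg G h s u v → PB (Λ u) (Λ v)) := by
    intro s
    refine dag_choice (wf_union hval hac s) ?_ ?_ PA PB hstep
    · intro u u' v h1 h2
      exact hval.1 v u u' h1.1.symm h2.1.symm (h1.2.2.trans h2.2.2.symm)
    · intro u u' v h1 h2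
      exact hval.1 v u u' h1.1.symm h2.1.symm (h1.2.2.trans h2.2.2.symm)
  choose Λ hΛ1 hΛ2 using key
  refine ⟨fun v s => Λ s v, ?_, fun w u v e => hΛ2 w u v e⟩
  intro w u v e
  refine hΛ1 (w + 1) u v ?_
  have : w + 1 + 2 = w := (fin3_add w).2.2.2.2.1
  rwa [this]

/-- Valid orders in the first regime. -/
def Ord1 (k r : ℕ) : Type := {f : ℕ → ℕ // (∀ j, 1 ≤ j → j ≤ k → 1 ≤ f j ∧ f j ≤ k) ∧
  (∀ i j, 1 ≤ i → i ≤ k → 1 ≤ j → j ≤ k → f i = f j → i = j) ∧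
  ∀ j, 1 ≤ j → j + r ≤ k → f j = j}

theorem regime1 [Fintype V] (hG : DegLe3 G) {k r : ℕ} (hr : r ≤ k) (N : ℕ) :
    (fracPower G (2 * k) (2 * k + 1 + r + N * (2 * k + 1))).Colorable (3 * k + 1) := by
  obtain ⟨h, hval, hac⟩ := exists_h hG
  have : Nonempty (Ord1 k r) := ⟨⟨id, fun j h1 h2 => ⟨h1, h2⟩, fun i j _ _ _ _ e => e,
    fun j _ _ => rfl⟩⟩
  obtain ⟨Λ, -, hB⟩ := exists_orders (X := Ord1 k r) hval hac (fun _ _ => True)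
    (fun x2 y => ∀ i j, 1 ≤ i → i ≤ k → 1 ≤ j → j ≤ k → x2.1 i = y.1 j → k + 1 ≤ i + r →
      2 * k + 1 ≤ i + j + r) (by
    rintro - ⟨x, hx1, hx2, hx3⟩
    refine ⟨⟨fun j => if j + r ≤ k then x j else x (2 * k + 1 - r - j), ?_, ?_, ?_⟩, trivial, ?_⟩
    · intro j h1 h2
      dsimp only
      split_ifs
      · exact hx1 _ (by omega) (by omega)
      · exact hx1 _ (by omega) (by omega)
    · intro i j hi1 hi2 hj1 hj2 e
      dsimp only at e
      split_ifs at e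
      · exact hx2 _ _ (by omega) (by omega) (by omega) (by omega) e
      · have := hx2 _ _ (by omega) (by omega) (by omega) (by omega) e
        omega
      · have := hx2 _ _ (by omega) (by omega) (by omega) (by omega) e
        omega
      · have := hx2 _ _ (by omega) (by omega) (by omega) (by omega) e
        omega
    · intro j h1 h2
      dsimp only
      rw [if_pos h2]; exact hx3 j h1 h2
    · intro i j hi1 hi2 hj1 hj2 e hir
      dsimp only at e
      split_ifs at e
      · have := hx2 _ _ (by omega) (by omega) (by omega) (by omega) e
        omega
      · have := hx2 _ _ (by omega) (by omega) (by omega) (by omega) e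
        omega)
  have hL1 : ∀ v s j, 1 ≤ j → j ≤ k → 1 ≤ (Λ v s).1 j ∧ (Λ v s).1 j ≤ k := fun v s => (Λ v s).2.1
  have hL2 : ∀ v s i j, 1 ≤ i → i ≤ k → 1 ≤ j → j ≤ k → (Λ v s).1 i = (Λ v s).1 j → i = j :=
    fun v s => (Λ v s).2.2.1
  have hL3 : ∀ v s j, 1 ≤ j → j + r ≤ k → (Λ v s).1 j = j := fun v s => (Λ v s).2.2.2
  generalize hLL : (fun v s => (Λ v s).1) = L
  have hLL' : ∀ v s, (Λ v s).1 = L v s := fun v s => congrFun (congrFun hLL v) s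
  simp only [hLL'] at hL1 hL2 hL3 hB
  clear hLL hLL'
  let A : V → V → ℕ → Col := fun u v i =>
    if i = 0 then Sum.inr 0 else Sum.inl (h u v, L u (h u v) i)
  have hA0 : ∀ u v, A u v 0 = Sum.inr 0 := fun u v => by simp [A]
  have hA1 : ∀ u v i, 1 ≤ i → A u v i = Sum.inl (h u v, L u (h u v) i) := fun u v i hi => by
    simp [A, Nat.one_le_iff_ne_zero.1 hi]
  have hmem : ∀ s v j, 1 ≤ j → j ≤ k → (Sum.inl (s, L v s j) : Col) ∈ colSet (Finset.Icc 1 k) {0} := by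
    intro s v j h1 h2
    rw [inl_mem_colSet, Finset.mem_Icc]
    exact hL1 v s j h1 h2
  have hcard : (colSet (Finset.Icc 1 k) {0}).card = 3 * k + 1 := by
    rw [colSet_card]; simp
  rw [← hcard]
  refine colorable_of_A (A := A) (c := fun _ => Sum.inr 0) ?_ (fun u v _ => hA0 u v) ?_ ?_ ?_ ?_ ?_
    ?_ N
  · intro u
    rw [inr_mem_colSet]; simp
  · intro u v huv i hi
    rcases Nat.eq_zero_or_pos i with rfl | h1
    · rw [hA0, inr_mem_colSet]; simp
    · rw [hA1 u v i h1]
      exact hmem _ _ _ h1 hi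
  · intro u v huv i j hij hj
    rw [hA1 u v j (by omega)]
    rcases Nat.eq_zero_or_pos i with rfl | h1
    · rw [hA0]; simp
    · rw [hA1 u v i h1]
      refine inl_ne (fun _ e => ?_)
      have := hL2 _ _ _ _ h1 (by omega) (by omega) hj e
      omega
  · intro u v v' h1 h2 hne i j hi hj hik hjk
    rw [hA1 u v i hi, hA1 u v' j hj]
    exact inl_ne (fun e _ => hne (hval.1 u v v' h1 h2 e))
  · intro u v huv i j hi hj hij
    rcases Nat.eq_zero_or_pos i with rfl | h1
    · rw [hA0, hA1 v u j (by omega)]; simp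
    · rw [hA1 u v i h1]
      rcases Nat.eq_zero_or_pos j with rfl | h2
      · rw [hA0]; simp
      · rw [hA1 v u j h2]
        exact inl_ne (fun e _ => hval.2 u v huv e)
  · intro u v v' h1 h2 hne i j hj hi hij
    rw [hA1 v u i (by omega), hA1 u v' j hj]
    refine inl_ne (fun e e' => ?_)
    rw [hL3 u _ j hj (by omega), ← hL3 v (h v u) j hj (by omega)] at e'
    have := hL2 _ _ _ _ (by omega) (by omega) (by omega) (by omega) e'
    omega
  · have main : ∀ w u v, Edg G h w u v → ∃ M, MidOK G (colSet (Finset.Icc 1 k) {0}) A k r u v M := by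
      intro w u v huv
      obtain ⟨w1, w2, w3, w4, w5, w6, w7⟩ := fin3_add w
      have hBuv := hB w u v huv
      obtain ⟨e1, e2, e3⟩ := huv
      refine ⟨fun a => Sum.inl (w, L u w (k + 1 - a)), ?_, ?_, ?_, ?_, ?_, ?_⟩
      · intro a h1 h2
        exact hmem _ _ _ (by omega) (by omega)
      · intro a b h1 h2 h3
        refine inl_ne (fun _ e => ?_)
        have := hL2 _ _ _ _ (by omega) (by omega) (by omega) (by omega) e
        omega
      · intro a i h1 h2 h3 h4
        rcases Nat.eq_zero_or_pos i with rfl | hi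
        · rw [hA0]; simp
        · rw [hA1 u v i hi]
          exact inl_ne (fun e _ => w1 (e.trans e2))
      · intro a i h1 h2 h3 h4
        rcases Nat.eq_zero_or_pos i with rfl | hi
        · rw [hA0]; simp
        · rw [hA1 v u i hi]
          exact inl_ne (fun e _ => w2 (e.trans e3))
      · intro v' hv' hne a j h1 h2 h3 h4
        rw [hA1 u v' j h3]
        refine inl_ne (fun e e' => ?_)
        rw [← e] at e'
        have := hL2 _ _ _ _ (by omega) (by omega) (by omega) (by omega) e'
        omega
      · intro u' hu' hne a j h1 h2 h3 h4
        rw [hA1 v u' j h3]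
        refine inl_ne (fun e e' => ?_)
        rw [← e] at e'
        have := hBuv _ _ (by omega) (by omega) (by omega) (by omega) e' (by omega)
        omega
    intro u v huv
    rcases edg_or hval huv with ⟨w, hw⟩ | ⟨w, hw⟩
    · exact Or.inl (main w u v hw)
    · exact Or.inr (main w v u hw)

end Part5

open SimpleGraph

/-! ## Part 6: the second regime -/

section Part6

variable {V : Type*} {G : SimpleGraph V}

theorem exists_enum (S : Finset ℕ) (hS : ∀ x ∈ S, 1 ≤ x) (d : ℕ) (hd : d ≤ S.card) :
    ∃ e : ℕ → ℕ, (∀ i, i < d → e i ∈ S ∧ i + 1 ≤ e i) ∧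
      ∀ i j, i < d → j < d → e i = e j → i = j := by
  let f := S.orderEmbOfFin rfl
  refine ⟨fun i => if h : i < S.card then f ⟨i, h⟩ else 0, ?_, ?_⟩
  · intro i hi
    have hi' : i < S.card := by omega
    simp only [dif_pos hi']
    refine ⟨Finset.orderEmbOfFin_mem S rfl _, ?_⟩
    clear hi
    induction i with
    | zero => exact hS _ (Finset.orderEmbOfFin_mem S rfl _)
    | succ i ih =>
      have h1 := ih (by omega)
      have h2 : f ⟨i, by omega⟩ < f ⟨i + 1, hi'⟩ := f.strictMono (by simp)
      omega
  · intro i j hi hj e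
    simp only [dif_pos (show i < S.card by omega), dif_pos (show j < S.card by omega)] at e
    have := f.injective e
    simpa using this

theorem exists_xy (c1 c2 p q : Fin 4) (h : c1 ≠ c2) : ∃ x y : Fin 4, x ≠ y ∧ x ≠ c1 ∧ x ≠ p ∧
    x ≠ q ∧ y ≠ c2 ∧ y ≠ p ∧ y ≠ q := by
  revert c1 c2 p q; decide

/-- Valid orders in the second regime. -/
def Ord2 (k p : ℕ) : Type := {f : ℕ → ℕ //
  (∀ j, 1 ≤ j → j ≤ k → j ≠ p → 1 ≤ f j ∧ f j ≤ k ∧ f j ≠ p) ∧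
  (∀ i j, 1 ≤ i → i ≤ k → i ≠ p → 1 ≤ j → j ≤ k → j ≠ p → f i = f j → i = j)}

theorem ord2_step {k p q : ℕ} (hk : q + p = k + 1) (hq : 1 ≤ q) (hqp : q ≤ p) (x1 x2 : Ord2 k p) :
    ∃ y : Ord2 k p, (∀ i, 1 ≤ i → i < q → y.1 (p + i) = x1.1 i) ∧
      ∀ i j, 1 ≤ i → i ≤ k → i ≠ p → 1 ≤ j → j ≤ k → j ≠ p → x2.1 i = y.1 j → p ≤ i + j := by
  classical
  obtain ⟨x1, h11, h12⟩ := x1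
  obtain ⟨x2, h21, h22⟩ := x2
  dsimp only
  let T : Finset ℕ := (Finset.Icc 1 k).erase p
  have hT : ∀ i, i ∈ T ↔ 1 ≤ i ∧ i ≤ k ∧ i ≠ p := by
    intro i; simp [T]; tauto
  have hTc : T.card = k - 1 := by
    have : p ∈ Finset.Icc 1 k := by rw [Finset.mem_Icc]; omega
    rw [Finset.card_erase_of_mem this]; simp
  let F : Finset ℕ := (Finset.Ico 1 q).image x1
  have hFc : F.card ≤ q - 1 := by
    refine Finset.card_image_le.trans ?_
    simp
  let Z := T.filter (fun i => x2 i ∈ F)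
  have hZc : Z.card ≤ F.card := by
    refine Finset.card_le_card_of_injOn x2 ?_ ?_
    · intro i hi
      exact (Finset.mem_filter.1 (Finset.mem_coe.1 hi)).2
    · intro i hi j hj e
      obtain ⟨a1, a2, a3⟩ := (hT i).1 (Finset.mem_filter.1 (Finset.mem_coe.1 hi)).1
      obtain ⟨b1, b2, b3⟩ := (hT j).1 (Finset.mem_filter.1 (Finset.mem_coe.1 hj)).1
      exact h22 i j a1 a2 a3 b1 b2 b3 e
  have hYc := Finset.card_filter_add_card_filter_not (s := T) (fun i => x2 i ∈ F)
  obtain ⟨e, he1, he2⟩ := exists_enum (T.filter (fun i => ¬ x2 i ∈ F)) (by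
    intro x hx
    exact ((hT x).1 (Finset.mem_filter.1 hx).1).1) (p - 1) (by
    change Z.card + _ = _ at hYc
    omega)
  have he3 : ∀ i, i < p - 1 → 1 ≤ e i ∧ e i ≤ k ∧ e i ≠ p ∧ x2 (e i) ∉ F ∧ i + 1 ≤ e i := by
    intro i hi
    obtain ⟨a, b⟩ := he1 i hi
    obtain ⟨a1, a2⟩ := Finset.mem_filter.1 a
    obtain ⟨b1, b2, b3⟩ := (hT _).1 a1
    exact ⟨b1, b2, b3, a2, b⟩
  have hF : ∀ i, 1 ≤ i → i < q → x1 i ∈ F := by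
    intro i h1 h2
    exact Finset.mem_image.2 ⟨i, by rw [Finset.mem_Ico]; omega, rfl⟩
  let y : ℕ → ℕ := fun j => if j < p then x2 (e (p - 1 - j)) else x1 (j - p)
  have hy1 : ∀ j, j < p → y j = x2 (e (p - 1 - j)) := fun j hj => by simp [y, hj]
  have hy2 : ∀ j, p < j → y j = x1 (j - p) := fun j hj => by
    simp [y, not_lt.2 hj.le]
  refine ⟨⟨y, ?_, ?_⟩, ?_, ?_⟩
  · intro j j1 j2 j3
    rcases lt_or_gt_of_ne j3 with h | h
    · rw [hy1 j h]
      obtain ⟨a1, a2, a3, -, -⟩ := he3 (p - 1 - j) (by omega)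
      exact h21 _ a1 a2 a3
    · rw [hy2 j h]
      exact h11 _ (by omega) (by omega) (by omega)
  · intro i j i1 i2 i3 j1 j2 j3 heq
    rcases lt_or_gt_of_ne i3 with h | h
    · obtain ⟨a1, a2, a3, a4, -⟩ := he3 (p - 1 - i) (by omega)
      rw [hy1 i h] at heq
      rcases lt_or_gt_of_ne j3 with h' | h'
      · obtain ⟨b1, b2, b3, b4, -⟩ := he3 (p - 1 - j) (by omega)
        rw [hy1 j h'] at heq
        have := he2 _ _ (by omega) (by omega) (h22 _ _ a1 a2 a3 b1 b2 b3 heq)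
        omega
      · rw [hy2 j h'] at heq
        exact absurd (heq ▸ hF _ (by omega) (by omega)) a4
    · rw [hy2 i h] at heq
      rcases lt_or_gt_of_ne j3 with h' | h'
      · obtain ⟨b1, b2, b3, b4, -⟩ := he3 (p - 1 - j) (by omega)
        rw [hy1 j h'] at heq
        exact absurd (heq ▸ hF _ (by omega) (by omega)) b4
      · rw [hy2 j h'] at heq
        have := h12 _ _ (by omega) (by omega) (by omega) (by omega) (by omega) (by omega) heq
        omega
  · intro i h1 h2
    dsimp only
    rw [hy2 _ (by omega)]
    congr 1; omega
  · intro i j i1 i2 i3 j1 j2 j3 heq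
    rcases lt_or_gt_of_ne j3 with h' | h'
    · obtain ⟨b1, b2, b3, b4, b5⟩ := he3 (p - 1 - j) (by omega)
      dsimp only at heq
      rw [hy1 j h'] at heq
      have := h22 _ _ i1 i2 i3 b1 b2 b3 heq
      omega
    · omega

theorem regime2 [Fintype V] (hG : DegLe3 G) {k p q : ℕ} (hk : q + p = k + 1) (hq : 1 ≤ q)
    (hqp : q ≤ p) (N : ℕ) :
    (fracPower G (2 * k) (2 * k + 1 + (k + q) + N * (2 * k + 1))).Colorable (3 * k + 1) := by
  obtain ⟨h, hval, hac⟩ := exists_h hG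
  obtain ⟨c, hc⟩ := exists_proper4 hG
  obtain ⟨o, ⟨hoinj, hoc⟩, ho⟩ := exists_o hG c
  have : Nonempty (Ord2 k p) := ⟨⟨id, fun j h1 h2 h3 => ⟨h1, h2, h3⟩, fun i j _ _ _ _ _ _ e => e⟩⟩
  obtain ⟨Λ, hPA, hPB⟩ := exists_orders (X := Ord2 k p) hval hac _ _ (ord2_step hk hq hqp)
  have hL1 : ∀ v s j, 1 ≤ j → j ≤ k → j ≠ p →
      1 ≤ (Λ v s).1 j ∧ (Λ v s).1 j ≤ k ∧ (Λ v s).1 j ≠ p := fun v s => (Λ v s).2.1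
  have hL2 : ∀ v s i j, 1 ≤ i → i ≤ k → i ≠ p → 1 ≤ j → j ≤ k → j ≠ p →
      (Λ v s).1 i = (Λ v s).1 j → i = j := fun v s => (Λ v s).2.2
  generalize hLL : (fun v s => (Λ v s).1) = L
  have hLL' : ∀ v s, (Λ v s).1 = L v s := fun v s => congrFun (congrFun hLL v) s
  simp only [hLL'] at hL1 hL2 hPA hPB
  clear hLL hLL'
  let A : V → V → ℕ → Col := fun u v i =>
    if i = 0 then Sum.inr (c u) else if i = p then Sum.inr (o u v) else
      Sum.inl (h u v, L u (h u v) i)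
  have hA0 : ∀ u v, A u v 0 = Sum.inr (c u) := fun u v => by simp [A]
  have hAp : ∀ u v, A u v p = Sum.inr (o u v) := fun u v => by
    simp [A, show p ≠ 0 by omega]
  have hA1 : ∀ u v i, i ≠ 0 → i ≠ p → A u v i = Sum.inl (h u v, L u (h u v) i) :=
    fun u v i hi hi' => by simp [A, hi, hi']
  let C := colSet ((Finset.Icc 1 k).erase p) Finset.univ
  have hmem : ∀ s v j, 1 ≤ j → j ≤ k → j ≠ p → (Sum.inl (s, L v s j) : Col) ∈ C := by
    intro s v j h1 h2 h3
    obtain ⟨a1, a2, a3⟩ := hL1 v s j h1 h2 h3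
    rw [inl_mem_colSet, Finset.mem_erase, Finset.mem_Icc]
    exact ⟨a3, a1, a2⟩
  have hmem' : ∀ s, (Sum.inr s : Col) ∈ C := fun s => by
    rw [inr_mem_colSet]; simp
  have hcard : C.card = 3 * k + 1 := by
    have : p ∈ Finset.Icc 1 k := by rw [Finset.mem_Icc]; omega
    rw [colSet_card, Finset.card_erase_of_mem this]
    simp only [Nat.card_Icc, Finset.card_univ, Fintype.card_fin]
    omega
  have hcase : ∀ i : ℕ, i = 0 ∨ i = p ∨ (i ≠ 0 ∧ i ≠ p) := fun i => by tauto
  rw [← hcard]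
  refine colorable_of_A (A := A) (c := fun u => Sum.inr (c u)) (fun u => hmem' _)
    (fun u v _ => hA0 u v) ?_ ?_ ?_ ?_ ?_ ?_ N
  · intro u v huv i hi
    rcases hcase i with rfl | rfl | ⟨h1, h2⟩
    · rw [hA0]; exact hmem' _
    · rw [hAp]; exact hmem' _
    · rw [hA1 u v i h1 h2]
      exact hmem _ _ _ (by omega) hi h2
  · intro u v huv i j hij hj
    rcases hcase j with rfl | rfl | ⟨h1, h2⟩
    · omega
    · rcases hcase i with rfl | rfl | ⟨h3, h4⟩
      · rw [hA0, hAp]; exact fun e => hoc u v huv (Sum.inr_injective e).symm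
      · omega
      · rw [hA1 u v i h3 h4, hAp]; simp
    · rw [hA1 u v j h1 h2]
      rcases hcase i with rfl | rfl | ⟨h3, h4⟩
      · rw [hA0]; simp
      · rw [hAp]; simp
      · rw [hA1 u v i h3 h4]
        refine inl_ne (fun _ e => ?_)
        have := hL2 _ _ _ _ (by omega) (by omega) h4 (by omega) hj h2 e
        omega
  · intro u v v' h1 h2 hne i j hi hj hik hjk
    rcases hcase i with rfl | rfl | ⟨h3, h4⟩
    · omega
    · rw [hAp]
      rcases hcase j with rfl | rfl | ⟨h5, h6⟩
      · omega
      · rw [hAp]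
        exact fun e => hne (hoinj u v v' h1 h2 (Sum.inr_injective e))
      · rw [hA1 u v' j h5 h6]; simp
    · rw [hA1 u v i h3 h4]
      rcases hcase j with rfl | rfl | ⟨h5, h6⟩
      · omega
      · rw [hAp]; simp
      · rw [hA1 u v' j h5 h6]
        exact inl_ne (fun e _ => hne (hval.1 u v v' h1 h2 e))
  · intro u v huv i j hi hj hij
    rcases hcase i with rfl | rfl | ⟨h3, h4⟩
    · omega
    · rw [hAp]
      rcases hcase j with rfl | rfl | ⟨h5, h6⟩
      · omega
      · rw [hAp]
        exact fun e => ho u v huv (Sum.inr_injective e)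
      · rw [hA1 v u j h5 h6]; simp
    · rw [hA1 u v i h3 h4]
      rcases hcase j with rfl | rfl | ⟨h5, h6⟩
      · omega
      · rw [hAp]; simp
      · rw [hA1 v u j h5 h6]
        exact inl_ne (fun e _ => hval.2 u v huv e)
  · intro u v v' h1 h2 hne i j hj hi hij
    omega
  · have main : ∀ w u v, Edg G h w u v → ∃ M, MidOK G C A k (k + q) u v M := by
      intro w u v huv
      obtain ⟨w1, w2, w3, w4, w5, w6, w7⟩ := fin3_add w
      have hA := hPA w u v huv
      have hB := hPB w u v huv
      obtain ⟨e1, e2, e3⟩ := huv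
      obtain ⟨x, y, hxy, hx1, hx2, hx3, hy1, hy2, hy3⟩ := exists_xy (c u) (c v) (o u v) (o v u)
        (hc u v e1)
      let M : ℕ → Col := fun a => if a = q then Sum.inr x else if a = k + 1 then Sum.inr y else
        if a ≤ k then Sum.inl (w, L u w (k + 1 - a)) else Sum.inl (w + 1, L u (w + 1) (a - k - 1))
      have hMq : M q = Sum.inr x := by simp [M]
      have hMk : M (k + 1) = Sum.inr y := by
        simp [M, show k + 1 ≠ q by omega]
      have hM1 : ∀ a, a ≤ k → a ≠ q → M a = Sum.inl (w, L u w (k + 1 - a)) := by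
        intro a h1 h2
        simp [M, h1, h2, show a ≠ k + 1 by omega]
      have hM2 : ∀ a, k + 2 ≤ a → M a = Sum.inl (w + 1, L u (w + 1) (a - k - 1)) := by
        intro a h1
        simp [M, show a ≠ q by omega, show a ≠ k + 1 by omega, show ¬ a ≤ k by omega]
      have hMc : ∀ a, a = q ∨ a = k + 1 ∨ (a ≤ k ∧ a ≠ q) ∨ k + 2 ≤ a := by
        intro a; omega
      refine ⟨M, ?_, ?_, ?_, ?_, ?_, ?_⟩
      · intro a h1 h2
        rcases hMc a with rfl | rfl | ⟨h3, h4⟩ | h3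
        · rw [hMq]; exact hmem' _
        · rw [hMk]; exact hmem' _
        · rw [hM1 a h3 h4]; exact hmem _ _ _ (by omega) (by omega) (by omega)
        · rw [hM2 a h3]; exact hmem _ _ _ (by omega) (by omega) (by omega)
      · intro a b h1 h2 h3
        rcases hMc a with rfl | rfl | ⟨h5, h6⟩ | h5
        · rw [hMq]
          rcases hMc b with rfl | rfl | ⟨h7, h8⟩ | h7
          · omega
          · rw [hMk]; exact fun e => hxy (Sum.inr_injective e)
          · rw [hM1 b h7 h8]; simp
          · rw [hM2 b h7]; simp
        · rw [hMk, hM2 b (by omega)]; simp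
        · rw [hM1 a h5 h6]
          rcases hMc b with rfl | rfl | ⟨h7, h8⟩ | h7
          · rw [hMq]; simp
          · rw [hMk]; simp
          · rw [hM1 b h7 h8]
            refine inl_ne (fun _ e => ?_)
            have := hL2 _ _ _ _ (by omega) (by omega) (by omega) (by omega) (by omega) (by omega) e
            omega
          · rw [hM2 b h7]
            exact inl_ne (fun e _ => w1 e)
        · rw [hM2 a h5, hM2 b (by omega)]
          refine inl_ne (fun _ e => ?_)
          have := hL2 _ _ _ _ (by omega) (by omega) (by omega) (by omega) (by omega) (by omega) e
          omega
      · intro a i h1 h2 h3 h4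
        rcases hcase i with rfl | rfl | ⟨h5, h6⟩
        · rw [hA0]
          rcases hMc a with rfl | rfl | ⟨h7, h8⟩ | h7
          · rw [hMq]; exact fun e => hx1 (Sum.inr_injective e)
          · omega
          · rw [hM1 a h7 h8]; simp
          · omega
        · rw [hAp]
          rcases hMc a with rfl | rfl | ⟨h7, h8⟩ | h7
          · rw [hMq]; exact fun e => hx2 (Sum.inr_injective e)
          · rw [hMk]; exact fun e => hy2 (Sum.inr_injective e)
          · rw [hM1 a h7 h8]; simp
          · rw [hM2 a h7]; simp
        · rw [hA1 u v i h5 h6, e2]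
          rcases hMc a with rfl | rfl | ⟨h7, h8⟩ | h7
          · rw [hMq]; simp
          · rw [hMk]; simp
          · rw [hM1 a h7 h8]; exact inl_ne (fun e _ => w1 e)
          · rw [hM2 a h7]
            refine inl_ne (fun _ e => ?_)
            have := hL2 _ _ _ _ (by omega) (by omega) (by omega) (by omega) (by omega) (by omega) e
            omega
      · intro a i h1 h2 h3 h4
        rcases hcase i with rfl | rfl | ⟨h5, h6⟩
        · rw [hA0]
          rcases hMc a with rfl | rfl | ⟨h7, h8⟩ | h7
          · omega
          · rw [hMk]; exact fun e => hy1 (Sum.inr_injective e)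
          · rw [hM1 a h7 h8]; simp
          · rw [hM2 a h7]; simp
        · rw [hAp]
          rcases hMc a with rfl | rfl | ⟨h7, h8⟩ | h7
          · rw [hMq]; exact fun e => hx3 (Sum.inr_injective e)
          · rw [hMk]; exact fun e => hy3 (Sum.inr_injective e)
          · rw [hM1 a h7 h8]; simp
          · rw [hM2 a h7]; simp
        · rw [hA1 v u i h5 h6, e3]
          rcases hMc a with rfl | rfl | ⟨h7, h8⟩ | h7
          · rw [hMq]; simp
          · rw [hMk]; simp
          · rw [hM1 a h7 h8]; exact inl_ne (fun e _ => w2 e)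
          · rw [hM2 a h7]; exact inl_ne (fun e _ => w3 e)
      · intro v' hv' hne a j h1 h2 h3 h4
        rcases hcase j with rfl | rfl | ⟨h5, h6⟩
        · omega
        · rw [hAp, hM1 a (by omega) (by omega)]; simp
        · rw [hA1 u v' j h5 h6]
          rcases hMc a with rfl | rfl | ⟨h7, h8⟩ | h7
          · rw [hMq]; simp
          · omega
          · rw [hM1 a h7 h8]
            refine inl_ne (fun e e' => ?_)
            rw [← e] at e'
            have := hL2 _ _ _ _ (by omega) (by omega) (by omega) (by omega) (by omega) (by omega) e'
            omega
          · omega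
      · intro u' hu' hne a j h1 h2 h3 h4
        rcases hcase j with rfl | rfl | ⟨h5, h6⟩
        · omega
        · rw [hAp]
          rcases hMc a with rfl | rfl | ⟨h7, h8⟩ | h7
          · omega
          · omega
          · omega
          · rw [hM2 a h7]; simp
        · rw [hA1 v u' j h5 h6]
          rcases hMc a with rfl | rfl | ⟨h7, h8⟩ | h7
          · rw [hMq]; simp
          · rw [hMk]; simp
          · rw [hM1 a h7 h8]
            refine inl_ne (fun e e' => ?_)
            rw [← e] at e'
            have := hB _ _ (by omega) (by omega) (by omega) (by omega) (by omega) h6 e'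
            omega
          · rw [hM2 a h7]
            refine inl_ne (fun e e' => ?_)
            rw [← e, ← hA (a - k - 1) (by omega) (by omega)] at e'
            have := hL2 _ _ _ _ (by omega) (by omega) (by omega) (by omega) (by omega) (by omega) e'
            omega
    intro u v huv
    rcases edg_or hval huv with ⟨w, hw⟩ | ⟨w, hw⟩
    · exact Or.inl (main w u v hw)
    · exact Or.inr (main w v u hw)

end Part6

open SimpleGraph

/-! ## Part 7: the third regime -/

section Part7

variable {V : Type*} {G : SimpleGraph V}

/-- The flip exchanging the low levels with the high levels. -/
def flipL (d e : ℕ) (β : Bool) (j : ℕ) : ℕ :=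
  if β = true then (if j ≤ d then j + e else if e < j then j - e else j) else j

/-- Ordinary levels. -/
def OLev (d e j : ℕ) : Prop := 1 ≤ j ∧ j ≤ d + e ∧ (j ≤ d ∨ e < j)

theorem flipL_mem {d e : ℕ} (hde : d ≤ e) (β : Bool) {j : ℕ} (hj : OLev d e j) :
    OLev d e (flipL d e β j) := by
  unfold flipL OLev at *
  split_ifs <;> omega

theorem flipL_inj {d e : ℕ} (hde : d ≤ e) (β : Bool) {i j : ℕ} (hi : OLev d e i)
    (hj : OLev d e j) (h : flipL d e β i = flipL d e β j) : i = j := by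
  unfold flipL OLev at *
  split_ifs at h <;> omega

theorem flipL_ne {d e : ℕ} (hde : d ≤ e) {β β' : Bool} (hβ : β ≠ β') {i j : ℕ} (hi : OLev d e i)
    (hj : OLev d e j) (h : flipL d e β i = flipL d e β' j) : i = j + e ∨ j = i + e := by
  unfold flipL OLev at *
  cases β <;> cases β' <;> simp only [if_true, if_false, Bool.false_eq_true] at h
  · exact absurd rfl hβ
  · split_ifs at h <;> omega
  · split_ifs at h <;> omega
  · exact absurd rfl hβ

/-- The levels used for the third type on an edge with two different types. -/
theorem exists_lvl {d e p q : ℕ} (hde : d ≤ e) (hde' : e ≤ d + 1) (hp : 1 ≤ p) (hpd : p ≤ d)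
    (hq : q + p = d + e + 1) (β β' : Bool) :
    ∃ lvl : ℕ → ℕ, (∀ a, e < a → a ≤ q + d → OLev d e (lvl a)) ∧
      (∀ a a', e < a → a ≤ q + d → e < a' → a' ≤ q + d → lvl a = lvl a' → a = a') ∧
      (∀ a j, e < a → a ≤ q + d → 1 ≤ j → a + j ≤ d + e → lvl a ≠ j) ∧
      (∀ a j, e < a → a ≤ q + d → OLev d e j → q + 1 + j ≤ a →
        flipL d e β (lvl a) ≠ flipL d e β' j) := by
  by_cases hβ : β = β'
  · subst hβ
    let lvl : ℕ → ℕ := fun a => if a ≤ d + e then (if p ≤ 2 * (d + e + 1 - a) then d + e + 1 - a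
      else a) else a - d
    have hO : ∀ a, e < a → a ≤ q + d → OLev d e (lvl a) := by
      intro a h1 h2
      simp only [lvl, OLev]
      split_ifs <;> omega
    refine ⟨lvl, hO, ?_, ?_, ?_⟩
    · intro a a' h1 h2 h3 h4 h5
      simp only [lvl] at h5
      split_ifs at h5 <;> omega
    · intro a j h1 h2 h3 h4 h5
      simp only [lvl] at h5
      split_ifs at h5 <;> omega
    · intro a j h1 h2 h3 h4 h5
      have := flipL_inj hde β (hO a h1 h2) h3 h5
      simp only [lvl] at this
      split_ifs at this <;> omega
  · let lvl : ℕ → ℕ := fun a => if a ≤ d + e then d + e + 1 - a else a + p - d - 1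
    have hO : ∀ a, e < a → a ≤ q + d → OLev d e (lvl a) := by
      intro a h1 h2
      simp only [lvl, OLev]
      split_ifs <;> omega
    refine ⟨lvl, hO, ?_, ?_, ?_⟩
    · intro a a' h1 h2 h3 h4 h5
      simp only [lvl] at h5
      split_ifs at h5 <;> omega
    · intro a j h1 h2 h3 h4 h5
      simp only [lvl] at h5
      split_ifs at h5 <;> omega
    · intro a j h1 h2 h3 h4 h5
      have := flipL_ne hde hβ (hO a h1 h2) h3 h5
      unfold OLev at h3
      simp only [lvl] at this
      split_ifs at this <;> omega

theorem regime3_aux [Fintype V] {d e p q : ℕ} (hde : d ≤ e) (hde' : e ≤ d + 1)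
    (hp : 1 ≤ p) (hpd : p ≤ d) (hq : q + p = d + e + 1) (S : Finset (Fin 4)) (c : V → Fin 4)
    (o : V → V → Fin 4) (h : V → V → Fin 3) (b : V → Fin 3 → Bool) (hh : HalfInj G h)
    (hb : ∀ u v, G.Adj u v → b u (h u v) ≠ b v (h u v)) (hcS : ∀ u, c u ∈ S)
    (hodd : d < e → S = Finset.univ ∧ (∀ u v, G.Adj u v → c u ≠ c v) ∧
      (∀ u v, G.Adj u v → o u v ≠ c u) ∧ HalfInj G o)
    (hcard : S.card + 3 * (2 * d) = 3 * (d + e) + 1) (N : ℕ) :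
    (fracPower G (2 * (d + e)) (2 * (d + e) + 1 + (d + e + q) + N * (2 * (d + e) + 1))).Colorable
      (3 * (d + e) + 1) := by
  classical
  let L : V → Fin 3 → ℕ → ℕ := fun u s => flipL d e (b u s)
  let T : Finset ℕ := Finset.Icc 1 d ∪ Finset.Icc (e + 1) (d + e)
  have hT : ∀ j, j ∈ T ↔ OLev d e j := by
    intro j
    simp only [T, OLev, Finset.mem_union, Finset.mem_Icc]
    omega
  have hTc : T.card = 2 * d := by
    rw [Finset.card_union_of_disjoint]
    · simp; omega
    · rw [Finset.disjoint_left]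
      intro j h1 h2
      rw [Finset.mem_Icc] at h1 h2
      omega
  let C := colSet T S
  have hCc : C.card = 3 * (d + e) + 1 := by
    rw [colSet_card, hTc]; omega
  have hL2 : ∀ u s i j, OLev d e i → OLev d e j → L u s i = L u s j → i = j :=
    fun u s i j h1 h2 h3 => flipL_inj hde (b u s) h1 h2 h3
  have hL3 : ∀ u v s i j, b u s ≠ b v s → OLev d e i → OLev d e j → L u s i = L v s j →
      i = j + e ∨ j = i + e := fun u v s i j h0 h1 h2 h3 => flipL_ne hde h0 h1 h2 h3
  have hL4 : ∀ u v s i j, b u s = b v s → OLev d e i → OLev d e j → L u s i = L v s j →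
      i = j := fun u v s i j h0 h1 h2 h3 => by
    refine flipL_inj hde (b u s) h1 h2 ?_
    simp only [L, ← h0] at h3
    exact h3
  have hmem : ∀ s v j, OLev d e j → (Sum.inl (s, L v s j) : Col) ∈ C := by
    intro s v j h1
    rw [inl_mem_colSet, hT]
    exact flipL_mem hde _ h1
  have hmem' : ∀ s, d < e → (Sum.inr s : Col) ∈ C := fun s hs => by
    rw [inr_mem_colSet, (hodd hs).1]; simp
  have hcas : ∀ u v, G.Adj u v → ∃ x y : Fin 4, d < e → (x ≠ y ∧ x ≠ c u ∧ x ≠ o u v ∧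
      x ≠ o v u ∧ y ≠ c v ∧ y ≠ o u v ∧ y ≠ o v u) := by
    intro u v huv
    by_cases hs : d < e
    · obtain ⟨x, y, hxy⟩ := exists_xy (c u) (c v) (o u v) (o v u) ((hodd hs).2.1 u v huv)
      exact ⟨x, y, fun _ => hxy⟩
    · exact ⟨0, 0, fun h => absurd h hs⟩
  let A : V → V → ℕ → Col := fun u v i =>
    if i = 0 then Sum.inr (c u) else if d < i ∧ i ≤ e then Sum.inr (o u v) else
      Sum.inl (h u v, L u (h u v) i)
  have hA0 : ∀ u v, A u v 0 = Sum.inr (c u) := fun u v => by simp [A]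
  have hAp : ∀ u v i, d < i → i ≤ e → A u v i = Sum.inr (o u v) := fun u v i h1 h2 => by
    simp [A, show i ≠ 0 by omega, h1, h2]
  have hA1 : ∀ u v i, OLev d e i → A u v i = Sum.inl (h u v, L u (h u v) i) :=
    fun u v i hi => by
      have h1 : i ≠ 0 := by unfold OLev at hi; omega
      have h2 : ¬ (d < i ∧ i ≤ e) := by unfold OLev at hi; omega
      simp only [A, h1, h2, if_false]
  have hcase : ∀ i : ℕ, i ≤ d + e → i = 0 ∨ (d < i ∧ i ≤ e) ∨ OLev d e i := fun i hi => by
    unfold OLev; omega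
  rw [← hCc]
  refine colorable_of_A (A := A) (c := fun u => Sum.inr (c u))
    (fun u => by rw [inr_mem_colSet]; exact hcS u)
    (fun u v _ => hA0 u v) ?_ ?_ ?_ ?_ ?_ ?_ N
  · intro u v huv i hi
    rcases hcase i hi with rfl | ⟨h1, h2⟩ | h1
    · rw [hA0, inr_mem_colSet]; exact hcS u
    · rw [hAp u v i h1 h2]; exact hmem' _ (by omega)
    · rw [hA1 u v i h1]
      exact hmem _ _ _ h1
  · intro u v huv i j hij hj
    rcases hcase j hj with rfl | ⟨h1, h2⟩ | h1
    · omega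
    · rw [hAp u v j h1 h2]
      rcases hcase i (by omega) with rfl | ⟨h3, h4⟩ | h3
      · rw [hA0]; exact fun e' => (hodd (by omega)).2.2.1 u v huv (Sum.inr_injective e').symm
      · omega
      · rw [hA1 u v i h3]; simp
    · rw [hA1 u v j h1]
      rcases hcase i (by omega) with rfl | ⟨h3, h4⟩ | h3
      · rw [hA0]; simp
      · rw [hAp u v i h3 h4]; simp
      · rw [hA1 u v i h3]
        refine inl_ne (fun _ e' => ?_)
        have := hL2 _ _ _ _ h3 h1 e'
        omega
  · intro u v v' h1 h2 hne i j hi hj hik hjk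
    rcases hcase i hik with rfl | ⟨h3, h4⟩ | h3
    · omega
    · rw [hAp u v i h3 h4]
      rcases hcase j hjk with rfl | ⟨h5, h6⟩ | h5
      · omega
      · rw [hAp u v' j h5 h6]
        exact fun e' => hne ((hodd (by omega)).2.2.2 u v v' h1 h2 (Sum.inr_injective e'))
      · rw [hA1 u v' j h5]; simp
    · rw [hA1 u v i h3]
      rcases hcase j hjk with rfl | ⟨h5, h6⟩ | h5
      · omega
      · rw [hAp u v' j h5 h6]; simp
      · rw [hA1 u v' j h5]
        exact inl_ne (fun e' _ => hne (hh u v v' h1 h2 e'))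
  · intro u v huv i j hi hj hij
    have h1 : OLev d e i := by unfold OLev; omega
    have h2 : OLev d e j := by unfold OLev; omega
    rw [hA1 u v i h1, hA1 v u j h2]
    refine inl_ne (fun e1 e2 => ?_)
    rw [← e1] at e2
    have := hL3 u v _ i j (hb u v huv) h1 h2 e2
    omega
  · intro u v v' h1 h2 hne i j hj hi hij
    omega
  · intro u v huv
    left
    obtain ⟨x, y, hxy⟩ := hcas u v huv
    have hflip1 := hb u v huv
    have hflip2 := hb v u huv.symm
    by_cases hst : h u v = h v u
    · -- equal types
      obtain ⟨w1, w2, w3, w4, w5, w6, w7⟩ := fin3_add (h u v)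
      generalize hs : h u v = s at *
      let M : ℕ → Col := fun a =>
        if a ≤ d + e then
          if d < a ∧ a ≤ e then Sum.inr x
          else if b u (s + 1) ≠ b v (s + 1) ∨ p ≤ 2 * (d + e + 1 - a) then
            Sum.inl (s + 1, L u (s + 1) (d + e + 1 - a))
          else Sum.inl (s + 2, L v (s + 2) (p - (d + e + 1 - a)))
        else if d < a - q ∧ a - q ≤ e then Sum.inr y
        else Sum.inl (s + 2, L v (s + 2) (a - q))
      have hM : ∀ a, 1 ≤ a → a ≤ d + e + q →
          (d < a ∧ a ≤ e ∧ M a = Sum.inr x) ∨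
          (a ≤ d + e ∧ OLev d e (d + e + 1 - a) ∧
            (b u (s + 1) ≠ b v (s + 1) ∨ p ≤ 2 * (d + e + 1 - a)) ∧
            M a = Sum.inl (s + 1, L u (s + 1) (d + e + 1 - a))) ∨
          (a ≤ d + e ∧ 2 * (d + e + 1 - a) < p ∧ OLev d e (p - (d + e + 1 - a)) ∧
            M a = Sum.inl (s + 2, L v (s + 2) (p - (d + e + 1 - a)))) ∨
          (d + e < a ∧ d < a - q ∧ a - q ≤ e ∧ M a = Sum.inr y) ∨
          (d + e < a ∧ OLev d e (a - q) ∧ M a = Sum.inl (s + 2, L v (s + 2) (a - q))) := by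
        intro a h1 h2
        by_cases h3 : a ≤ d + e
        · by_cases h4 : d < a ∧ a ≤ e
          · left
            simp only [M, if_pos h3, if_pos h4]
            exact ⟨h4.1, h4.2, trivial⟩
          · right
            by_cases h5 : b u (s + 1) ≠ b v (s + 1) ∨ p ≤ 2 * (d + e + 1 - a)
            · left
              simp only [M, if_pos h3, if_neg h4, if_pos h5]
              exact ⟨h3, by unfold OLev; omega, h5, trivial⟩
            · right; left
              simp only [M, if_pos h3, if_neg h4, if_neg h5]
              push Not at h5
              exact ⟨h3, h5.2, by unfold OLev; omega, trivial⟩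
        · right; right; right
          by_cases h4 : d < a - q ∧ a - q ≤ e
          · left
            simp only [M, if_neg h3, if_pos h4]
            exact ⟨by omega, h4.1, h4.2, trivial⟩
          · right
            simp only [M, if_neg h3, if_neg h4]
            exact ⟨by omega, by unfold OLev; omega, trivial⟩
      refine ⟨M, ?_, ?_, ?_, ?_, ?_, ?_⟩
      · intro a h1 h2
        rcases hM a h1 h2 with ⟨h3, h4, he⟩ | ⟨h3, h4, h5, he⟩ | ⟨h3, h4, h5, he⟩ |
          ⟨h3, h4, h5, he⟩ | ⟨h3, h4, he⟩ <;> rw [he]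
        · exact hmem' _ (by omega)
        · exact hmem _ _ _ h4
        · exact hmem _ _ _ h5
        · exact hmem' _ (by omega)
        · exact hmem _ _ _ h4
      · intro a a' h1 h2 h3
        rcases hM a h1 (by omega) with ⟨a3, a4, he⟩ | ⟨a3, a4, a5, he⟩ | ⟨a3, a4, a5, he⟩ |
          ⟨a3, a4, a5, he⟩ | ⟨a3, a4, he⟩ <;>
        rcases hM a' (by omega) h3 with ⟨b3, b4, he'⟩ | ⟨b3, b4, b5, he'⟩ | ⟨b3, b4, b5, he'⟩ |
          ⟨b3, b4, b5, he'⟩ | ⟨b3, b4, he'⟩ <;> rw [he, he'] <;>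
        first
          | (simp; done)
          | (exact inl_ne (fun e1 _ => w3 e1))
          | (exact inl_ne (fun e1 _ => w3 e1.symm))
          | omega
          | (exact fun e1 => (hxy (by omega)).1 (Sum.inr_injective e1))
          | (refine inl_ne (fun _ e2 => ?_)
             have := hL2 _ _ _ _ (by assumption) (by assumption) e2
             omega)
      · intro a i h1 h2 h3 h4
        rcases hcase i h3 with rfl | ⟨h5, h6⟩ | h5
        · rw [hA0]
          rcases hM a h1 h2 with ⟨a3, a4, he⟩ | ⟨a3, a4, a5, he⟩ | ⟨a3, a4, a5, he⟩ |
            ⟨a3, a4, a5, he⟩ | ⟨a3, a4, he⟩ <;> rw [he] <;>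
          first
            | (simp; done)
            | omega
            | (exact fun e1 => (hxy (by omega)).2.1 (Sum.inr_injective e1))
        · rw [hAp u v i h5 h6]
          rcases hM a h1 h2 with ⟨a3, a4, he⟩ | ⟨a3, a4, a5, he⟩ | ⟨a3, a4, a5, he⟩ |
            ⟨a3, a4, a5, he⟩ | ⟨a3, a4, he⟩ <;> rw [he] <;>
          first
            | (simp; done)
            | (exact fun e1 => (hxy (by omega)).2.2.1 (Sum.inr_injective e1))
            | (exact fun e1 => (hxy (by omega)).2.2.2.2.2.1 (Sum.inr_injective e1))
        · rw [hA1 u v i h5, hs]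
          rcases hM a h1 h2 with ⟨a3, a4, he⟩ | ⟨a3, a4, a5, he⟩ | ⟨a3, a4, a5, he⟩ |
            ⟨a3, a4, a5, he⟩ | ⟨a3, a4, he⟩ <;> rw [he] <;>
          first
            | (simp; done)
            | (exact inl_ne (fun e1 _ => w1 e1.symm))
            | (exact inl_ne (fun e1 _ => w2 e1.symm))
      · intro a i h1 h2 h3 h4
        rcases hcase i h3 with rfl | ⟨h5, h6⟩ | h5
        · rw [hA0]
          rcases hM a h1 h2 with ⟨a3, a4, he⟩ | ⟨a3, a4, a5, he⟩ | ⟨a3, a4, a5, he⟩ |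
            ⟨a3, a4, a5, he⟩ | ⟨a3, a4, he⟩ <;> rw [he] <;>
          first
            | (simp; done)
            | omega
            | (exact fun e1 => (hxy (by omega)).2.2.2.2.1 (Sum.inr_injective e1))
        · rw [hAp v u i h5 h6]
          rcases hM a h1 h2 with ⟨a3, a4, he⟩ | ⟨a3, a4, a5, he⟩ | ⟨a3, a4, a5, he⟩ |
            ⟨a3, a4, a5, he⟩ | ⟨a3, a4, he⟩ <;> rw [he] <;>
          first
            | (simp; done)
            | (exact fun e1 => (hxy (by omega)).2.2.2.1 (Sum.inr_injective e1))
            | (exact fun e1 => (hxy (by omega)).2.2.2.2.2.2 (Sum.inr_injective e1))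
        · rw [hA1 v u i h5, ← hst]
          rcases hM a h1 h2 with ⟨a3, a4, he⟩ | ⟨a3, a4, a5, he⟩ | ⟨a3, a4, a5, he⟩ |
            ⟨a3, a4, a5, he⟩ | ⟨a3, a4, he⟩ <;> rw [he] <;>
          first
            | (simp; done)
            | (exact inl_ne (fun e1 _ => w1 e1.symm))
            | (exact inl_ne (fun e1 _ => w2 e1.symm))
      · intro v' hv' hne a j h1 h2 h3 h4
        rcases hcase j (by omega) with rfl | ⟨h5, h6⟩ | h5
        · omega
        · rw [hAp u v' j h5 h6]
          rcases hM a h1 h2 with ⟨a3, a4, he⟩ | ⟨a3, a4, a5, he⟩ | ⟨a3, a4, a5, he⟩ |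
            ⟨a3, a4, a5, he⟩ | ⟨a3, a4, he⟩ <;> rw [he] <;>
          first
            | (simp; done)
            | omega
        · rw [hA1 u v' j h5]
          rcases hM a h1 h2 with ⟨a3, a4, he⟩ | ⟨a3, a4, a5, he⟩ | ⟨a3, a4, a5, he⟩ |
            ⟨a3, a4, a5, he⟩ | ⟨a3, a4, he⟩ <;> rw [he]
          · simp
          · refine inl_ne (fun e1 e2 => ?_)
            rw [← e1] at e2
            have := hL2 _ _ _ _ a4 h5 e2
            omega
          · refine inl_ne (fun e1 e2 => ?_)
            rw [← e1] at e2
            by_cases hbb : b v (s + 2) = b u (s + 2)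
            · have := hL4 _ _ _ _ _ hbb a5 h5 e2
              omega
            · have := hL3 _ _ _ _ _ hbb a5 h5 e2
              omega
          · simp
          · omega
      · intro u' hu' hne a j h1 h2 h3 h4
        have hjk : j ≤ d + e := by omega
        rcases hcase j hjk with rfl | ⟨h5, h6⟩ | h5
        · omega
        · rw [hAp v u' j h5 h6]
          rcases hM a h1 h2 with ⟨a3, a4, he⟩ | ⟨a3, a4, a5, he⟩ | ⟨a3, a4, a5, he⟩ |
            ⟨a3, a4, a5, he⟩ | ⟨a3, a4, he⟩ <;> rw [he] <;>
          first
            | (simp; done)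
            | omega
        · rw [hA1 v u' j h5]
          rcases hM a h1 h2 with ⟨a3, a4, he⟩ | ⟨a3, a4, a5, he⟩ | ⟨a3, a4, a5, he⟩ |
            ⟨a3, a4, a5, he⟩ | ⟨a3, a4, he⟩ <;> rw [he]
          · simp
          · refine inl_ne (fun e1 e2 => ?_)
            rw [← e1] at e2
            by_cases hbb : b u (s + 1) = b v (s + 1)
            · have := hL4 _ _ _ _ _ hbb a4 h5 e2
              rcases a5 with a5 | a5
              · exact a5 hbb
              · omega
            · have := hL3 _ _ _ _ _ hbb a4 h5 e2
              omega
          · refine inl_ne (fun e1 e2 => ?_)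
            rw [← e1] at e2
            have := hL2 _ _ _ _ a5 h5 e2
            omega
          · simp
          · refine inl_ne (fun e1 e2 => ?_)
            rw [← e1] at e2
            have := hL2 _ _ _ _ a4 h5 e2
            omega
    · -- different types
      obtain ⟨w, hws, hwt⟩ : ∃ w : Fin 3, w ≠ h u v ∧ w ≠ h v u :=
        (by decide : ∀ s t : Fin 3, ∃ w : Fin 3, w ≠ s ∧ w ≠ t) _ _
      obtain ⟨lvl, hl1, hl2, hl3, hl4⟩ := exists_lvl hde hde' hp hpd hq (b u w) (b v w)
      have hl4' : ∀ a j, e < a → a ≤ q + d → OLev d e j → q + 1 + j ≤ a →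
        L u w (lvl a) ≠ L v w j := hl4
      clear hl4
      generalize hs : h u v = s at *
      generalize ht : h v u = t at *
      let M : ℕ → Col := fun a =>
        if a ≤ d then Sum.inl (t, L u t (d + e + 1 - a))
        else if a ≤ e then Sum.inr x
        else if a ≤ q + d then Sum.inl (w, L u w (lvl a))
        else if a ≤ q + e then Sum.inr y
        else Sum.inl (s, L u s (a - q - e))
      have hM : ∀ a, 1 ≤ a → a ≤ d + e + q →
          (a ≤ d ∧ OLev d e (d + e + 1 - a) ∧ M a = Sum.inl (t, L u t (d + e + 1 - a))) ∨
          (d < a ∧ a ≤ e ∧ M a = Sum.inr x) ∨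
          (e < a ∧ a ≤ q + d ∧ OLev d e (lvl a) ∧ M a = Sum.inl (w, L u w (lvl a))) ∨
          (q + d < a ∧ a ≤ q + e ∧ M a = Sum.inr y) ∨
          (q + e < a ∧ OLev d e (a - q - e) ∧ M a = Sum.inl (s, L u s (a - q - e))) := by
        intro a h1 h2
        by_cases h3 : a ≤ d
        · left
          simp only [M, if_pos h3]
          exact ⟨h3, by unfold OLev; omega, trivial⟩
        right
        by_cases h4 : a ≤ e
        · left
          simp only [M, if_neg h3, if_pos h4]
          exact ⟨by omega, h4, trivial⟩
        right
        by_cases h5 : a ≤ q + d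
        · left
          simp only [M, if_neg h3, if_neg h4, if_pos h5]
          exact ⟨by omega, h5, hl1 a (by omega) h5, trivial⟩
        right
        by_cases h6 : a ≤ q + e
        · left
          simp only [M, if_neg h3, if_neg h4, if_neg h5, if_pos h6]
          exact ⟨by omega, h6, trivial⟩
        right
        simp only [M, if_neg h3, if_neg h4, if_neg h5, if_neg h6]
        exact ⟨by omega, by unfold OLev; omega, trivial⟩
      refine ⟨M, ?_, ?_, ?_, ?_, ?_, ?_⟩
      · intro a h1 h2
        rcases hM a h1 h2 with ⟨h3, h4, he⟩ | ⟨h3, h4, he⟩ | ⟨h3, h4, h5, he⟩ |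
          ⟨h3, h4, he⟩ | ⟨h3, h4, he⟩ <;> rw [he]
        · exact hmem _ _ _ h4
        · exact hmem' _ (by omega)
        · exact hmem _ _ _ h5
        · exact hmem' _ (by omega)
        · exact hmem _ _ _ h4
      · intro a a' h1 h2 h3
        rcases hM a h1 (by omega) with ⟨a3, a4, he⟩ | ⟨a3, a4, he⟩ | ⟨a3, a4, a5, he⟩ |
          ⟨a3, a4, he⟩ | ⟨a3, a4, he⟩ <;>
        rcases hM a' (by omega) h3 with ⟨b3, b4, he'⟩ | ⟨b3, b4, he'⟩ | ⟨b3, b4, b5, he'⟩ |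
          ⟨b3, b4, he'⟩ | ⟨b3, b4, he'⟩ <;> rw [he, he'] <;>
        first
          | (simp; done)
          | (exact inl_ne (fun e1 _ => hws e1))
          | (exact inl_ne (fun e1 _ => hwt e1))
          | (exact inl_ne (fun e1 _ => hws e1.symm))
          | (exact inl_ne (fun e1 _ => hwt e1.symm))
          | (exact inl_ne (fun e1 _ => hst e1.symm))
          | omega
          | (exact fun e1 => (hxy (by omega)).1 (Sum.inr_injective e1))
          | (refine inl_ne (fun _ e2 => ?_)
             have := hL2 _ _ _ _ (by assumption) (by assumption) e2
             omega)
          | (refine inl_ne (fun _ e2 => ?_)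
             have := hl2 a a' (by assumption) (by assumption) (by assumption) (by assumption)
               (hL2 _ _ _ _ (by assumption) (by assumption) e2)
             omega)
      · intro a i h1 h2 h3 h4
        rcases hcase i h3 with rfl | ⟨h5, h6⟩ | h5
        · rw [hA0]
          rcases hM a h1 h2 with ⟨a3, a4, he⟩ | ⟨a3, a4, he⟩ | ⟨a3, a4, a5, he⟩ |
            ⟨a3, a4, he⟩ | ⟨a3, a4, he⟩ <;> rw [he] <;>
          first
            | (simp; done)
            | omega
            | (exact fun e1 => (hxy (by omega)).2.1 (Sum.inr_injective e1))
        · rw [hAp u v i h5 h6]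
          rcases hM a h1 h2 with ⟨a3, a4, he⟩ | ⟨a3, a4, he⟩ | ⟨a3, a4, a5, he⟩ |
            ⟨a3, a4, he⟩ | ⟨a3, a4, he⟩ <;> rw [he] <;>
          first
            | (simp; done)
            | (exact fun e1 => (hxy (by omega)).2.2.1 (Sum.inr_injective e1))
            | (exact fun e1 => (hxy (by omega)).2.2.2.2.2.1 (Sum.inr_injective e1))
        · rw [hA1 u v i h5, hs]
          rcases hM a h1 h2 with ⟨a3, a4, he⟩ | ⟨a3, a4, he⟩ | ⟨a3, a4, a5, he⟩ |
            ⟨a3, a4, he⟩ | ⟨a3, a4, he⟩ <;> rw [he]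
          · exact inl_ne (fun e1 _ => hst e1.symm)
          · simp
          · exact inl_ne (fun e1 _ => hws e1)
          · simp
          · refine inl_ne (fun _ e2 => ?_)
            have := hL2 _ _ _ _ a4 h5 e2
            omega
      · intro a i h1 h2 h3 h4
        rcases hcase i h3 with rfl | ⟨h5, h6⟩ | h5
        · rw [hA0]
          rcases hM a h1 h2 with ⟨a3, a4, he⟩ | ⟨a3, a4, he⟩ | ⟨a3, a4, a5, he⟩ |
            ⟨a3, a4, he⟩ | ⟨a3, a4, he⟩ <;> rw [he] <;>
          first
            | (simp; done)
            | omega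
            | (exact fun e1 => (hxy (by omega)).2.2.2.2.1 (Sum.inr_injective e1))
        · rw [hAp v u i h5 h6]
          rcases hM a h1 h2 with ⟨a3, a4, he⟩ | ⟨a3, a4, he⟩ | ⟨a3, a4, a5, he⟩ |
            ⟨a3, a4, he⟩ | ⟨a3, a4, he⟩ <;> rw [he] <;>
          first
            | (simp; done)
            | (exact fun e1 => (hxy (by omega)).2.2.2.1 (Sum.inr_injective e1))
            | (exact fun e1 => (hxy (by omega)).2.2.2.2.2.2 (Sum.inr_injective e1))
        · rw [hA1 v u i h5, ht]
          rcases hM a h1 h2 with ⟨a3, a4, he⟩ | ⟨a3, a4, he⟩ | ⟨a3, a4, a5, he⟩ |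
            ⟨a3, a4, he⟩ | ⟨a3, a4, he⟩ <;> rw [he]
          · refine inl_ne (fun _ e2 => ?_)
            have := hL3 _ _ _ _ _ hflip2.symm a4 h5 e2
            unfold OLev at h5
            omega
          · simp
          · exact inl_ne (fun e1 _ => hwt e1)
          · simp
          · exact inl_ne (fun e1 _ => hst e1)
      · intro v' hv' hne a j h1 h2 h3 h4
        rcases hcase j (by omega) with rfl | ⟨h5, h6⟩ | h5
        · omega
        · rw [hAp u v' j h5 h6]
          rcases hM a h1 h2 with ⟨a3, a4, he⟩ | ⟨a3, a4, he⟩ | ⟨a3, a4, a5, he⟩ |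
            ⟨a3, a4, he⟩ | ⟨a3, a4, he⟩ <;> rw [he] <;>
          first
            | (simp; done)
            | omega
        · rw [hA1 u v' j h5]
          rcases hM a h1 h2 with ⟨a3, a4, he⟩ | ⟨a3, a4, he⟩ | ⟨a3, a4, a5, he⟩ |
            ⟨a3, a4, he⟩ | ⟨a3, a4, he⟩ <;> rw [he]
          · refine inl_ne (fun e1 e2 => ?_)
            rw [← e1] at e2
            have := hL2 _ _ _ _ a4 h5 e2
            omega
          · simp
          · refine inl_ne (fun e1 e2 => ?_)
            rw [← e1] at e2
            exact hl3 a j a3 a4 h3 h4 (hL2 _ _ _ _ a5 h5 e2)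
          · simp
          · omega
      · intro u' hu' hne a j h1 h2 h3 h4
        have hjk : j ≤ d + e := by omega
        rcases hcase j hjk with rfl | ⟨h5, h6⟩ | h5
        · omega
        · rw [hAp v u' j h5 h6]
          rcases hM a h1 h2 with ⟨a3, a4, he⟩ | ⟨a3, a4, he⟩ | ⟨a3, a4, a5, he⟩ |
            ⟨a3, a4, he⟩ | ⟨a3, a4, he⟩ <;> rw [he] <;>
          first
            | (simp; done)
            | omega
        · rw [hA1 v u' j h5]
          rcases hM a h1 h2 with ⟨a3, a4, he⟩ | ⟨a3, a4, he⟩ | ⟨a3, a4, a5, he⟩ |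
            ⟨a3, a4, he⟩ | ⟨a3, a4, he⟩ <;> rw [he]
          · omega
          · simp
          · refine inl_ne (fun e1 e2 => ?_)
            rw [← e1] at e2
            exact hl4' a j a3 a4 h5 (by omega) e2
          · simp
          · refine inl_ne (fun e1 e2 => ?_)
            rw [← e1] at e2
            have := hL3 _ _ _ _ _ hflip1 a4 h5 e2
            omega

theorem regime3 [Fintype V] (hG : DegLe3 G) {k p q : ℕ} (hk : q + p = k + 1) (hp : 1 ≤ p)
    (hpk : 2 * p ≤ k) (N : ℕ) :
    (fracPower G (2 * k) (2 * k + 1 + (k + q) + N * (2 * k + 1))).Colorable (3 * k + 1) := by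
  obtain ⟨h, b, hh, hb⟩ := exists_bits hG
  rcases Nat.even_or_odd' k with ⟨d, rfl | rfl⟩
  · have := regime3_aux (G := G) (d := d) (e := d) (p := p) (q := q) le_rfl (by omega) hp (by omega)
      (by omega) {0} (fun _ => 0) (fun _ _ => 0) h b hh hb (by simp) (fun h => absurd h (lt_irrefl d))
      (by simp; omega) N
    rw [← two_mul] at this
    exact this
  · obtain ⟨c, hc⟩ := exists_proper4 hG
    have := regime3_aux (G := G) (d := d) (e := d + 1) (p := p) (q := q) (by omega) (by omega) hp
      (by omega) (by omega) Finset.univ c (fun u v => (c u).succAbove (h u v)) h b hh hb (by simp)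
      (fun _ => ⟨rfl, hc, fun u v _ => Fin.succAbove_ne _ _, fun u v v' h1 h2 e =>
        hh u v v' h1 h2 (Fin.succAbove_right_injective e)⟩)
      (by simp; omega) N
    have e : d + (d + 1) = 2 * d + 1 := by ring
    rw [e] at this
    exact this

end Part7

open SimpleGraph

theorem upper_bound {V : Type*} [Fintype V] {G : SimpleGraph V} (hG : DegLe3 G) {k n : ℕ}
    (hn : 2 * k < n) : (fracPower G (2 * k) n).Colorable (3 * k + 1) := by
  obtain ⟨N, r, hr, rfl⟩ : ∃ N r, r ≤ 2 * k ∧ n = 2 * k + 1 + r + N * (2 * k + 1) := by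
    refine ⟨(n - (2 * k + 1)) / (2 * k + 1), (n - (2 * k + 1)) % (2 * k + 1), ?_, ?_⟩
    · have := Nat.mod_lt (n - (2 * k + 1)) (show 0 < 2 * k + 1 by omega)
      omega
    · have := Nat.mod_add_div' (n - (2 * k + 1)) (2 * k + 1)
      omega
  by_cases h1 : r ≤ k
  · exact regime1 hG h1 N
  · obtain ⟨q, rfl⟩ : ∃ q, r = k + q := ⟨r - k, by omega⟩
    by_cases h2 : 2 * q ≤ k + 1
    · exact regime2 hG (p := k + 1 - q) (by omega) (by omega) (by omega) N
    · exact regime3 hG (p := k + 1 - q) (by omega) (by omega) (by omega) N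

theorem chromatic_of_even_power_maxDegree_three {V : Type*} [Fintype V] (G : SimpleGraph V)
    [DecidableRel G.Adj] (hΔ : G.maxDegree = 3)
    (m n : ℕ) (hm : Even m) (hm2 : 2 ≤ m) (hmn : m < n) :
    (fracPower G m n).chromaticNumber = ((3 * m / 2 + 1 : ℕ) : ℕ∞) := by
  obtain ⟨k, rfl⟩ := hm
  have e1 : 3 * (k + k) / 2 + 1 = 3 * k + 1 := by omega
  rw [e1, ← two_mul]
  have hG : DegLe3 G := by
    classical
    intro v S hS
    have h1 : S ⊆ G.neighborFinset v := fun y hy => (G.mem_neighborFinset v y).2 (hS y hy)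
    have h2 := Finset.card_le_card h1
    have h3 := G.degree_le_maxDegree v
    rw [G.card_neighborFinset_eq_degree] at h2
    omega
  have hV : Nonempty V := by
    by_contra hcon
    rw [not_nonempty_iff] at hcon
    have : G.maxDegree = 0 := by
      simp
    omega
  obtain ⟨u, hu⟩ := G.exists_maximal_degree_vertex
  apply le_antisymm
  · exact (upper_bound hG (by omega)).chromaticNumber_le
  · rw [SimpleGraph.le_chromaticNumber_iff_colorable]
    intro N hN
    exact lower_bound (k := k) (by omega) u (by omega) hN
end

section
/- Let G be the triangular prism, i.e., the Cartesian product C_3 □ K_2 of the 3-cycle with K_2. Then χ(G^{3/5}) > ω(G^{3/5}); in fact ω(G^{3/5}) = 5 and χ(G^{3/5}) ≥ 6. -/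
open SimpleGraph

/-- The triangular prism. -/
abbrev Prism : SimpleGraph (Fin 3 × Fin 2) := SimpleGraph.cycleGraph 3 □ (⊤ : SimpleGraph (Fin 2))

/-- Number of a vertex of the prism. -/
def vid (u : Fin 3 × Fin 2) : ℕ := 2 * u.1.val + u.2.val

/-- Number of the edge `uv`, `u < v`. -/
def eid (a b : ℕ) : ℕ :=
  match a, b with
  | 0, 1 => 0 | 0, 2 => 1 | 0, 4 => 2 | 1, 3 => 3 | 1, 5 => 4
  | 2, 3 => 5 | 2, 4 => 6 | 3, 5 => 7 | 4, 5 => 8 | _, _ => 9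

/-- Number of a point of the subdivision. -/
def encT (p : (Fin 3 × Fin 2) × (Fin 3 × Fin 2) × ℕ) : ℕ :=
  if p.2.2 = 0 then vid p.1 else if p.2.2 = 5 then vid p.2.1
  else if vid p.1 < vid p.2.1 then 6 + 4 * eid (vid p.1) (vid p.2.1) + (p.2.2 - 1)
  else 6 + 4 * eid (vid p.2.1) (vid p.1) + (4 - p.2.2)

theorem prism_adj (u v : Fin 3 × Fin 2) :
    Prism.Adj u v ↔ ((u.1 ≠ v.1 ∧ u.2 = v.2) ∨ (u.1 = v.1 ∧ u.2 ≠ v.2)) := by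
  rw [boxProd_adj, cycleGraph_three_eq_top, top_adj, top_adj]
  tauto

theorem encT_flip : ∀ u v : Fin 3 × Fin 2, ∀ i : Fin 6, Prism.Adj u v →
    encT (u, v, i.val) = encT (v, u, 5 - i.val) := by
  simp only [prism_adj]; decide

/-- The numbering of the points of the subdivision. -/
def enc : SubdivVert Prism 5 → ℕ :=
  Quot.lift (fun p => encT p.1) (by
    intro a b h
    cases h with
    | flip u v i h hi => exact encT_flip u v ⟨i, by omega⟩ h
    | collapse u v h => simp [encT])

theorem enc_mk {u v : Fin 3 × Fin 2} (h : Prism.Adj u v) (i : ℕ) (hi : i ≤ 5) :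
    enc (mkVert Prism 5 h i hi) = encT (u, v, i) := rfl

theorem enc_branch (u : Fin 3 × Fin 2) : enc (branchVertex Prism 5 u) = vid u := rfl

theorem mk_flip {V : Type*} (G : SimpleGraph V) {u v : V} (h : G.Adj u v) (i j : ℕ) (hi : i ≤ 5)
    (hj : j ≤ 5) (hij : i + j = 5) : mkVert G 5 h i hi = mkVert G 5 h.symm j hj := by
  obtain rfl : j = 5 - i := by omega
  exact Quot.sound (SubdivRel.flip u v i h hi)

theorem mk_zero {V : Type*} (G : SimpleGraph V) {u v : V} (h : G.Adj u v) :
    mkVert G 5 h 0 (by omega) = branchVertex G 5 u :=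
  Quot.sound (SubdivRel.collapse u v h)

theorem normal_form (x : SubdivVert Prism 5) :
    (∃ u, x = branchVertex Prism 5 u) ∨
    ∃ (u v : Fin 3 × Fin 2) (h : Prism.Adj u v) (i : ℕ) (hi : i ≤ 5),
      x = mkVert Prism 5 h i hi ∧ vid u < vid v ∧ 1 ≤ i ∧ i ≤ 4 := by
  induction x using Quot.ind with
  | mk p =>
    obtain ⟨⟨u, v, i⟩, hp⟩ := p
    rcases hp with ⟨h1, h2⟩ | ⟨h, hi⟩
    · simp only at h1 h2
      subst h1 h2
      exact Or.inl ⟨u, rfl⟩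
    · change Prism.Adj u v at h
      change i ≤ 5 at hi
      change (∃ w, mkVert Prism 5 h i hi = _) ∨
        ∃ (u' v' : Fin 3 × Fin 2) (h' : Prism.Adj u' v') (i' : ℕ) (hi' : i' ≤ 5),
        mkVert Prism 5 h i hi = mkVert Prism 5 h' i' hi' ∧ vid u' < vid v' ∧ 1 ≤ i' ∧ i' ≤ 4
      by_cases h0 : i = 0
      · subst h0
        exact Or.inl ⟨u, mk_zero Prism h⟩
      by_cases h5 : i = 5
      · subst h5
        exact Or.inl ⟨v, (mk_flip Prism h 5 0 hi (by omega) rfl).trans (mk_zero Prism h.symm)⟩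
      rcases lt_trichotomy (vid u) (vid v) with hl | hl | hl
      · exact Or.inr ⟨u, v, h, i, hi, rfl, hl, by omega, by omega⟩
      · exfalso
        revert h hl
        rw [prism_adj]
        clear * -
        revert u v
        decide
      · exact Or.inr ⟨v, u, h.symm, 5 - i, by omega, mk_flip Prism h _ _ _ _ (by omega), hl,
          by omega, by omega⟩

/-- Left inverse of the numbering on normal forms. -/
def decT (k : ℕ) : ℕ × ℕ × ℕ :=
  if k < 6 then (k, k, 0) else
  match (k - 6) / 4 with
  | 0 => (0, 1, (k - 6) % 4) | 1 => (0, 2, (k - 6) % 4) | 2 => (0, 4, (k - 6) % 4)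
  | 3 => (1, 3, (k - 6) % 4) | 4 => (1, 5, (k - 6) % 4) | 5 => (2, 3, (k - 6) % 4)
  | 6 => (2, 4, (k - 6) % 4) | 7 => (3, 5, (k - 6) % 4) | _ => (4, 5, (k - 6) % 4)

theorem vid_inj : ∀ u v : Fin 3 × Fin 2, vid u = vid v → u = v := by decide

theorem vid_lt : ∀ u : Fin 3 × Fin 2, vid u < 6 := by decide

theorem decT_encT : ∀ u v : Fin 3 × Fin 2, ∀ j : Fin 4, Prism.Adj u v → vid u < vid v →
    decT (encT (u, v, j.val + 1)) = (vid u, vid v, j.val) ∧ 6 ≤ encT (u, v, j.val + 1) ∧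
      encT (u, v, j.val + 1) < 42 := by
  simp only [prism_adj]; decide

theorem enc_lt (x : SubdivVert Prism 5) : enc x < 42 := by
  rcases normal_form x with ⟨u, rfl⟩ | ⟨u, v, h, i, hi, rfl, hl, h1, h4⟩
  · rw [enc_branch]; have := vid_lt u; omega
  · obtain ⟨j, rfl⟩ : ∃ j, i = j + 1 := ⟨i - 1, by omega⟩
    exact (decT_encT u v ⟨j, by omega⟩ h hl).2.2

theorem enc_injective : Function.Injective enc := by
  intro x y hxy
  rcases normal_form x with ⟨u, rfl⟩ | ⟨u, v, h, i, hi, rfl, hl, h1, h4⟩ <;>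
  rcases normal_form y with ⟨u', rfl⟩ | ⟨u', v', h', i', hi', rfl, hl', h1', h4'⟩
  · rw [enc_branch, enc_branch] at hxy
    rw [vid_inj _ _ hxy]
  · obtain ⟨j, rfl⟩ : ∃ j, i' = j + 1 := ⟨i' - 1, by omega⟩
    have := (decT_encT u' v' ⟨j, by omega⟩ h' hl').2.1
    rw [enc_branch, enc_mk] at hxy
    have := vid_lt u
    simp only at *
    omega
  · obtain ⟨j, rfl⟩ : ∃ j, i = j + 1 := ⟨i - 1, by omega⟩
    have := (decT_encT u v ⟨j, by omega⟩ h hl).2.1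
    rw [enc_branch, enc_mk] at hxy
    have := vid_lt u'
    simp only at *
    omega
  · obtain ⟨j, rfl⟩ : ∃ j, i = j + 1 := ⟨i - 1, by omega⟩
    obtain ⟨j', rfl⟩ : ∃ j, i' = j + 1 := ⟨i' - 1, by omega⟩
    have e1 := (decT_encT u v ⟨j, by omega⟩ h hl).1
    have e2 := (decT_encT u' v' ⟨j', by omega⟩ h' hl').1
    rw [enc_mk, enc_mk] at hxy
    simp only at e1 e2
    rw [hxy, e2] at e1
    simp only [Prod.mk.injEq] at e1
    obtain ⟨a, b, c⟩ := e1
    obtain rfl := vid_inj _ _ a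
    obtain rfl := vid_inj _ _ b
    subst c
    rfl

/-! ### Upper bound on the clique number -/

/-- Row `a` is the bit mask of the points within distance `1` of point `a`. -/
def prismBall1 : List ℕ :=
  [17473, 4456962, 1140858884, 17718837256, 283467972624, 2336495763488, 193, 448, 896, 770,
   3073, 7168, 14336, 12292, 49153, 114688, 229376, 196624, 786434, 1835008, 3670016, 3145736,
   12582914, 29360128, 58720256, 50331680, 201326596, 469762048, 939524096, 805306376,
   3221225476, 7516192768, 15032385536, 12884901904, 51539607560, 120259084288, 240518168576,
   206158430240, 824633720848, 1924145348608, 3848290697216, 3298534883360]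

/-- Row `a` is the bit mask of the points within distance `2` of point `a`. -/
def prismBall2 : List ℕ :=
  [52417, 13370114, 3422564356, 52348059656, 837518819344, 3504743645216, 17857, 961, 962,
   4457346, 23617, 15361, 15364, 1140865028, 115777, 245761, 245776, 283468070928, 6029826,
   3932162, 3932168, 17720410120, 29622786, 62914562, 62914592, 2336520929312, 1543512068,
   1006632964, 1006632968, 18121490440, 7583309828, 16106127364, 16106127376, 289910423568,
   120798052360, 257698037768, 257698037792, 2439574978592, 1932735414288, 4123168604176,
   4123168604192, 3985763205152]

/-- Row `a` is the bit mask of the points within distance `3` of point `a`. -/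
def prismBall3 : List ℕ :=
  [122305, 31196034, 7985969156, 121202278408, 1939177963536, 4088867586080, 53185, 18371,
   4457411, 13370306, 64705, 31813, 1140866053, 3422567428, 249025, 246865, 283468087313,
   837518868496, 16515842, 8126986, 17720672266, 52348846088, 63701762, 63177250,
   2336525123618, 3504756228128, 4227870724, 2080382988, 18188599308, 52549386248, 16307466244,
   16173244436, 290984165396, 840740044816, 258506489864, 258237005864, 2456754847784,
   3556283252768, 4136053702672, 4131758669872, 4260641112112, 4329377366048]

/-- Balls of radius `k ≤ 3` as bit masks. -/
def prismBall (k a : ℕ) : ℕ :=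
  match k with
  | 0 => 2 ^ a
  | 1 => prismBall1.getD a 0
  | 2 => prismBall2.getD a 0
  | _ => prismBall3.getD a 0

theorem ball_step : ∀ k : Fin 3, ∀ u v : Fin 3 × Fin 2, ∀ i : Fin 5,
    Prism.Adj u v →
    (prismBall k (encT (u, v, i.val + 1)) ||| prismBall (k + 1) (encT (u, v, i.val)) =
      prismBall (k + 1) (encT (u, v, i.val))) ∧
    (prismBall k (encT (u, v, i.val)) ||| prismBall (k + 1) (encT (u, v, i.val + 1)) =
      prismBall (k + 1) (encT (u, v, i.val + 1))) := by
  simp only [prism_adj]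
  decide +kernel

theorem ball_mono : ∀ k : Fin 3, ∀ a : Fin 42,
    prismBall k a ||| prismBall 3 a = prismBall 3 a := by
  decide +kernel

theorem testBit_of_or {a b c : ℕ} (h : a ||| b = b) (ha : a.testBit c = true) :
    b.testBit c = true := by
  rw [← h, Nat.testBit_or, ha, Bool.true_or]

theorem walk_ball {x y : SubdivVert Prism 5} (w : (subdivision Prism 5).Walk x y) :
    w.length ≤ 3 → (prismBall w.length (enc x)).testBit (enc y) = true := by
  induction w with
  | nil => intro _; simp [prismBall]
  | @cons x z y hadj w ih =>
    intro hl
    rw [Walk.length_cons] at hl ⊢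
    specialize ih (by omega)
    unfold subdivision at hadj
    rw [fromRel_adj] at hadj
    rcases hadj.2 with ⟨u, v, h, i, hi, rfl, rfl⟩ | ⟨u, v, h, i, hi, rfl, rfl⟩
    · exact testBit_of_or (ball_step ⟨w.length, by omega⟩ u v ⟨i, hi⟩ h).1 ih
    · exact testBit_of_or (ball_step ⟨w.length, by omega⟩ u v ⟨i, hi⟩ h).2 ih

theorem walk_ball3 {x y : SubdivVert Prism 5} (w : (subdivision Prism 5).Walk x y)
    (hw : w.length ≤ 3) : (prismBall3.getD (enc x) 0).testBit (enc y) = true := by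
  have h := walk_ball w hw
  by_cases h3 : w.length = 3
  · rw [h3] at h; exact h
  · exact testBit_of_or (ball_mono ⟨w.length, by omega⟩ ⟨enc x, enc_lt x⟩) h

/-- Checks that no `n` points of the list form a clique. -/
def noClique : ℕ → List ℕ → Bool
  | 0, _ => false
  | n + 1, L => L.all fun a =>
      noClique n (L.filter fun b => Nat.blt a b && (prismBall3.getD a 0).testBit b)

theorem noClique_sound (n : ℕ) : ∀ L : List ℕ, noClique n L = true → ∀ S : Finset ℕ,
    (∀ a ∈ S, a ∈ L) → (∀ a ∈ S, ∀ b ∈ S, a ≠ b → (prismBall3.getD a 0).testBit b = true) →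
    S.card < n := by
  induction n with
  | zero => intro L h; simp [noClique] at h
  | succ n ih =>
    intro L h S hS hadj
    rcases S.eq_empty_or_nonempty with rfl | hne
    · simp
    have hm := S.min'_mem hne
    set m := S.min' hne with hmd
    rw [noClique, List.all_eq_true] at h
    have := ih _ (h m (hS m hm)) (S.erase m) (by
      intro b hb
      have hb' := Finset.mem_of_mem_erase hb
      have hlt : m < b := S.min'_lt_of_mem_erase_min' hne hb
      rw [List.mem_filter]
      refine ⟨hS b hb', ?_⟩
      rw [hadj m hm b hb' hlt.ne, Bool.and_true]
      simpa using hlt) (by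
      intro a ha b hb hab
      exact hadj a (Finset.mem_of_mem_erase ha) b (Finset.mem_of_mem_erase hb) hab)
    rw [Finset.card_erase_of_mem hm] at this
    omega

theorem noClique_six : noClique 6 (List.range 42) = true := by
  decide +kernel

theorem frac_adj {V : Type*} (G : SimpleGraph V) {x y : SubdivVert G 5} :
    (fracPower G 3 5).Adj x y ↔ x ≠ y ∧ ∃ w : (subdivision G 5).Walk x y, w.length ≤ 3 := by
  unfold fracPower powerGraph
  rw [fromRel_adj]
  refine and_congr_right fun _ => ⟨?_, Or.inl⟩
  rintro (h | ⟨w, hw⟩)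
  · exact h
  · exact ⟨w.reverse, by simpa using hw⟩

theorem clique_le {s : Finset (SubdivVert Prism 5)} (hs : (fracPower Prism 3 5).IsClique s) :
    s.card ≤ 5 := by
  classical
  have := noClique_sound 6 _ noClique_six (s.image enc) (by
    intro a ha
    obtain ⟨x, _, rfl⟩ := Finset.mem_image.1 ha
    exact List.mem_range.2 (enc_lt x)) (by
    intro a ha b hb hab
    obtain ⟨x, hx, rfl⟩ := Finset.mem_image.1 ha
    obtain ⟨y, hy, rfl⟩ := Finset.mem_image.1 hb
    have hxy : x ≠ y := fun h => hab (by rw [h])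
    obtain ⟨w, hw⟩ := ((frac_adj Prism).1 (hs hx hy hxy)).2
    exact walk_ball3 w hw)
  rw [Finset.card_image_of_injective _ enc_injective] at this
  omega

/-! ### Adjacencies -/

theorem walk_along {V : Type*} (G : SimpleGraph V) {u v : V} (h : G.Adj u v) (i k : ℕ)
    (hk : i + k ≤ 5) : ∃ w : (subdivision G 5).Walk (mkVert G 5 h i (by omega))
      (mkVert G 5 h (i + k) hk), w.length ≤ k := by
  induction k with
  | zero => exact ⟨Walk.nil, le_rfl⟩
  | succ k ih =>
    obtain ⟨w, hw⟩ := ih (by omega)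
    by_cases he : mkVert G 5 h (i + k) (by omega) = mkVert G 5 h (i + (k + 1)) hk
    · exact ⟨w.copy rfl he, by simpa using by omega⟩
    · have ha : (subdivision G 5).Adj (mkVert G 5 h (i + k) (by omega))
          (mkVert G 5 h (i + (k + 1)) hk) := by
        unfold subdivision
        rw [fromRel_adj]
        exact ⟨he, Or.inl ⟨u, v, h, i + k, by omega, rfl, rfl⟩⟩
      exact ⟨w.concat ha, by rw [Walk.length_concat]; omega⟩

theorem adj_along {u v : Fin 3 × Fin 2} (h : Prism.Adj u v) (i j : ℕ) (hij : i < j) (hj : j ≤ 5)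
    (hd : j ≤ i + 3) : (fracPower Prism 3 5).Adj (mkVert Prism 5 h i (by omega))
      (mkVert Prism 5 h j hj) := by
  rw [frac_adj]
  constructor
  · intro he
    have he := congrArg enc he
    rw [enc_mk, enc_mk] at he
    have key : ∀ u v : Fin 3 × Fin 2, Prism.Adj u v → ∀ i j : Fin 6, i < j →
        encT (u, v, i.val) ≠ encT (u, v, j.val) := by
      simp only [prism_adj]; decide +kernel
    exact key u v h ⟨i, by omega⟩ ⟨j, by omega⟩ hij he
  · obtain ⟨k, rfl⟩ : ∃ k, j = i + k := ⟨j - i, by omega⟩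
    obtain ⟨w, hw⟩ := walk_along Prism h i k hj
    exact ⟨w, by omega⟩

set_option synthInstance.maxSize 2000 in
set_option synthInstance.maxHeartbeats 200000 in
theorem adj_across {u v v' : Fin 3 × Fin 2} (h : Prism.Adj u v) (h' : Prism.Adj u v')
    (hv : v ≠ v') (i j : ℕ) (hi : 1 ≤ i) (hj : 1 ≤ j) (hd : i + j ≤ 3) :
    (fracPower Prism 3 5).Adj (mkVert Prism 5 h i (by omega))
      (mkVert Prism 5 h' j (by omega)) := by
  rw [frac_adj]
  constructor
  · intro he
    have he := congrArg enc he
    rw [enc_mk, enc_mk] at he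
    have key : ∀ u v v' : Fin 3 × Fin 2, Prism.Adj u v → Prism.Adj u v' → v ≠ v' →
        ∀ i j : Fin 2, encT (u, v, i.val + 1) ≠ encT (u, v', j.val + 1) := by
      simp only [prism_adj]; decide +kernel
    obtain ⟨i, rfl⟩ : ∃ k, i = k + 1 := ⟨i - 1, by omega⟩
    obtain ⟨j, rfl⟩ : ∃ k, j = k + 1 := ⟨j - 1, by omega⟩
    exact key u v v' h h' hv ⟨i, by omega⟩ ⟨j, by omega⟩ he
  · obtain ⟨w, hw⟩ := walk_along Prism h 0 i (by omega)
    obtain ⟨w', hw'⟩ := walk_along Prism h' 0 j (by omega)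
    have e : mkVert Prism 5 h 0 (by omega) = mkVert Prism 5 h' 0 (by omega) :=
      (mk_zero Prism h).trans (mk_zero Prism h').symm
    have e1 : mkVert Prism 5 h (0 + i) (by omega) = mkVert Prism 5 h i (by omega) := by
      congr 1; omega
    have e2 : mkVert Prism 5 h' (0 + j) (by omega) = mkVert Prism 5 h' j (by omega) := by
      congr 1; omega
    refine ⟨((w.reverse).append (w'.copy e.symm rfl)).copy e1 e2, ?_⟩
    rw [Walk.length_copy, Walk.length_append, Walk.length_reverse, Walk.length_copy]
    omega

theorem exists_clique : ∃ s, (fracPower Prism 3 5).IsNClique 5 s := by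
  classical
  have h1 : Prism.Adj (0, 0) (0, 1) := by rw [prism_adj]; decide
  have h2 : Prism.Adj (0, 0) (1, 0) := by rw [prism_adj]; decide
  have h3 : Prism.Adj (0, 0) (2, 0) := by rw [prism_adj]; decide
  have z2 := mk_zero Prism h2
  have z3 := mk_zero Prism h3
  rw [← mk_zero Prism h1] at z2 z3
  have n12 : ((0, 1) : Fin 3 × Fin 2) ≠ (1, 0) := by decide
  have n13 : ((0, 1) : Fin 3 × Fin 2) ≠ (2, 0) := by decide
  have n23 : ((1, 0) : Fin 3 × Fin 2) ≠ (2, 0) := by decide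
  have b1 := adj_along h1 0 1 (by omega) (by omega) (by omega)
  have b1' := adj_along h1 0 2 (by omega) (by omega) (by omega)
  have b2 := adj_along h2 0 1 (by omega) (by omega) (by omega)
  have b3 := adj_along h3 0 1 (by omega) (by omega) (by omega)
  rw [z2] at b2
  rw [z3] at b3
  have c1 := adj_along h1 1 2 (by omega) (by omega) (by omega)
  have c12 := adj_across h1 h2 n12 1 1 (by omega) (by omega) (by omega)
  have c13 := adj_across h1 h3 n13 1 1 (by omega) (by omega) (by omega)
  have c23 := adj_across h2 h3 n23 1 1 (by omega) (by omega) (by omega)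
  have d12 := adj_across h1 h2 n12 2 1 (by omega) (by omega) (by omega)
  have d13 := adj_across h1 h3 n13 2 1 (by omega) (by omega) (by omega)
  refine ⟨{mkVert Prism 5 h1 0 (by omega), mkVert Prism 5 h1 1 (by omega),
    mkVert Prism 5 h1 2 (by omega), mkVert Prism 5 h2 1 (by omega),
    mkVert Prism 5 h3 1 (by omega)}, ?_⟩
  refine ((((is3Clique_triple_iff.2 ⟨d12, d13, c23⟩).insert ?_)).insert ?_)
  · simp only [Finset.mem_insert, Finset.mem_singleton]
    rintro b (rfl | rfl | rfl)
    exacts [c1, c12, c13]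
  · simp only [Finset.mem_insert, Finset.mem_singleton]
    rintro b (rfl | rfl | rfl | rfl)
    exacts [b1, b1', b2, b3]

/-! ### No 5-colouring -/

theorem pigeon (c1 c2 c3 c4 c5 y : Fin 5) (h12 : c1 ≠ c2) (h13 : c1 ≠ c3) (h14 : c1 ≠ c4)
    (h15 : c1 ≠ c5) (h23 : c2 ≠ c3) (h24 : c2 ≠ c4) (h25 : c2 ≠ c5) (h34 : c3 ≠ c4)
    (h35 : c3 ≠ c5) (h45 : c4 ≠ c5) (y1 : y ≠ c1) (y2 : y ≠ c2) (y3 : y ≠ c3) :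
    y = c4 ∨ y = c5 := by
  omega

/-- One triangle of the prism: `di` the colour of the points at distance two from the `i`-th
vertex, `aij` and `bi` the colours of its neighbours, `xi` the colour `d` at the other triangle. -/
theorem triangle_lemma {α : Type*} (d1 d2 d3 x1 x2 x3 a12 a13 a21 a23 a31 a32 b1 b2 b3 : α)
    (hd12 : d1 ≠ d2) (hd13 : d1 ≠ d3) (hd23 : d2 ≠ d3)
    (p12 : d2 = a13 ∨ d2 = b1) (p13 : d3 = a12 ∨ d3 = b1) (p1 : x1 = a12 ∨ x1 = a13)
    (p21 : d1 = a23 ∨ d1 = b2) (p23 : d3 = a21 ∨ d3 = b2) (p2 : x2 = a21 ∨ x2 = a23)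
    (p31 : d1 = a32 ∨ d1 = b3) (p32 : d2 = a31 ∨ d2 = b3) (p3 : x3 = a31 ∨ x3 = a32)
    (q12 : a12 ≠ a21) (q13 : a13 ≠ a31) (q23 : a23 ≠ a32)
    (r1 : a12 ≠ a13) (r1' : a12 ≠ b1) (r1'' : a13 ≠ b1)
    (r2 : a21 ≠ a23) (r2' : a21 ≠ b2) (r2'' : a23 ≠ b2)
    (r3 : a31 ≠ a32) (r3' : a31 ≠ b3) (r3'' : a32 ≠ b3)
    (e1 : d1 ≠ x1) (e2 : d2 ≠ x2) (e3 : d3 ≠ x3) :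
    (b1 = d2 ∧ b2 = d3 ∧ b3 = d1 ∧ x1 ≠ d2 ∧ x2 ≠ d3 ∧ x3 ≠ d1) ∨
    (b1 = d3 ∧ b2 = d1 ∧ b3 = d2 ∧ x1 ≠ d3 ∧ x2 ≠ d1 ∧ x3 ≠ d2) := by
  grind (splits := 30)

theorem prism_lemma (d1 d2 d3 x1 x2 x3 b1 b2 b3 c1 c2 c3 : Fin 5)
    (hd12 : d1 ≠ d2) (hd13 : d1 ≠ d3) (hd23 : d2 ≠ d3)
    (hx12 : x1 ≠ x2) (hx13 : x1 ≠ x3) (hx23 : x2 ≠ x3)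
    (e1 : d1 ≠ x1) (e2 : d2 ≠ x2) (e3 : d3 ≠ x3)
    (f1 : b1 ≠ c1) (f2 : b2 ≠ c2) (f3 : b3 ≠ c3)
    (h : (b1 = d2 ∧ b2 = d3 ∧ b3 = d1 ∧ x1 ≠ d2 ∧ x2 ≠ d3 ∧ x3 ≠ d1) ∨
      (b1 = d3 ∧ b2 = d1 ∧ b3 = d2 ∧ x1 ≠ d3 ∧ x2 ≠ d1 ∧ x3 ≠ d2))
    (k : (c1 = x2 ∧ c2 = x3 ∧ c3 = x1 ∧ d1 ≠ x2 ∧ d2 ≠ x3 ∧ d3 ≠ x1) ∨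
      (c1 = x3 ∧ c2 = x1 ∧ c3 = x2 ∧ d1 ≠ x3 ∧ d2 ≠ x1 ∧ d3 ≠ x2)) : False := by
  have key : x1 ≠ d2 → x1 ≠ d3 → x2 ≠ d1 → x2 ≠ d3 → x3 ≠ d1 → x3 ≠ d2 → False := by
    intro h1 h2 h3 h4 h5 h6
    rcases pigeon d1 d2 d3 x1 x2 x3 hd12 hd13 e1 h3.symm hd23 h1.symm e2 h2.symm h4.symm hx12
      h5 h6 e3.symm with h | h
    · exact hx13 h.symm
    · exact hx23 h.symm
  rcases h with ⟨rfl, rfl, rfl, h1, h2, h3⟩ | ⟨rfl, rfl, rfl, h1, h2, h3⟩ <;>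
  rcases k with ⟨rfl, rfl, rfl, k1, k2, k3⟩ | ⟨rfl, rfl, rfl, k1, k2, k3⟩ <;>
  apply key <;> first | assumption | (apply Ne.symm; assumption)

theorem not_colorable : ¬ (fracPower Prism 3 5).Colorable 5 := by
  rintro ⟨C⟩
  -- local structure at a vertex
  have loc : ∀ {u v w z : Fin 3 × Fin 2} (hv : Prism.Adj u v) (hw : Prism.Adj u w)
      (hz : Prism.Adj u z), v ≠ w → v ≠ z → w ≠ z →
      C (mkVert Prism 5 hv 2 (by omega)) = C (mkVert Prism 5 hw 2 (by omega)) ∧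
      C (mkVert Prism 5 hv 1 (by omega)) ≠ C (mkVert Prism 5 hw 1 (by omega)) ∧
      C (mkVert Prism 5 hv 1 (by omega)) ≠ C (mkVert Prism 5 hv.symm 1 (by omega)) ∧
      C (mkVert Prism 5 hv 2 (by omega)) ≠ C (mkVert Prism 5 hv.symm 2 (by omega)) ∧
      (C (mkVert Prism 5 hv.symm 2 (by omega)) = C (mkVert Prism 5 hw 1 (by omega)) ∨
       C (mkVert Prism 5 hv.symm 2 (by omega)) = C (mkVert Prism 5 hz 1 (by omega))) := by
    intro u v w z hv hw hz nvw nvz nwz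
    have zw := (mk_zero Prism hw).trans (mk_zero Prism hv).symm
    have zz := (mk_zero Prism hz).trans (mk_zero Prism hv).symm
    have s3 := mk_flip Prism hv 3 2 (by omega) (by omega) rfl
    have s4 := mk_flip Prism hv 4 1 (by omega) (by omega) rfl
    have v01 := C.valid (adj_along hv 0 1 (by omega) (by omega) (by omega))
    have v02 := C.valid (adj_along hv 0 2 (by omega) (by omega) (by omega))
    have v03 := C.valid (adj_along hv 0 3 (by omega) (by omega) (by omega))
    have v12 := C.valid (adj_along hv 1 2 (by omega) (by omega) (by omega))
    have v13 := C.valid (adj_along hv 1 3 (by omega) (by omega) (by omega))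
    have v14 := C.valid (adj_along hv 1 4 (by omega) (by omega) (by omega))
    have v23 := C.valid (adj_along hv 2 3 (by omega) (by omega) (by omega))
    have w01 := C.valid (adj_along hw 0 1 (by omega) (by omega) (by omega))
    have w02 := C.valid (adj_along hw 0 2 (by omega) (by omega) (by omega))
    have w12 := C.valid (adj_along hw 1 2 (by omega) (by omega) (by omega))
    have z01 := C.valid (adj_along hz 0 1 (by omega) (by omega) (by omega))
    rw [zw] at w01 w02
    rw [zz] at z01
    rw [s3] at v03 v13 v23
    rw [s4] at v14
    have vw := C.valid (adj_across hv hw nvw 1 1 (by omega) (by omega) (by omega))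
    have vz := C.valid (adj_across hv hz nvz 1 1 (by omega) (by omega) (by omega))
    have wz := C.valid (adj_across hw hz nwz 1 1 (by omega) (by omega) (by omega))
    have v2w := C.valid (adj_across hv hw nvw 2 1 (by omega) (by omega) (by omega))
    have v2z := C.valid (adj_across hv hz nvz 2 1 (by omega) (by omega) (by omega))
    have w2v := C.valid (adj_across hv hw nvw 1 2 (by omega) (by omega) (by omega))
    have w2z := C.valid (adj_across hw hz nwz 2 1 (by omega) (by omega) (by omega))
    generalize C (mkVert Prism 5 hv 0 _) = c0 at *
    generalize C (mkVert Prism 5 hv 1 _) = cv1 at *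
    generalize C (mkVert Prism 5 hw 1 _) = cw1 at *
    generalize C (mkVert Prism 5 hz 1 _) = cz1 at *
    generalize C (mkVert Prism 5 hv 2 _) = cv2 at *
    generalize C (mkVert Prism 5 hw 2 _) = cw2 at *
    generalize C (mkVert Prism 5 hv.symm 2 _) = e2 at *
    generalize C (mkVert Prism 5 hv.symm 1 _) = e1 at *
    clear * - v01 v02 v03 v12 v13 v14 v23 w01 w02 w12 z01 vw vz wz v2w v2z w2v w2z
    have hE : cv2 = cw2 := by
      rcases pigeon c0 cv1 cw1 cz1 cv2 cw2 v01 w01 z01 v02 vw vz v12 wz v2w.symm v2z.symm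
        w02.symm w2v.symm w12.symm with h | h
      · exact absurd h w2z
      · exact h.symm
    exact ⟨hE, vw, v14, v23, pigeon c0 cv1 cv2 cw1 cz1 e2 v01 v02 w01 z01 v12 vw vz v2w v2z wz
      v03.symm v13.symm v23.symm⟩
  -- the edges of the prism
  have t12 : Prism.Adj (0, 0) (1, 0) := by rw [prism_adj]; decide
  have t13 : Prism.Adj (0, 0) (2, 0) := by rw [prism_adj]; decide
  have t23 : Prism.Adj (1, 0) (2, 0) := by rw [prism_adj]; decide
  have s12 : Prism.Adj (0, 1) (1, 1) := by rw [prism_adj]; decide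
  have s13 : Prism.Adj (0, 1) (2, 1) := by rw [prism_adj]; decide
  have s23 : Prism.Adj (1, 1) (2, 1) := by rw [prism_adj]; decide
  have m1 : Prism.Adj (0, 0) (0, 1) := by rw [prism_adj]; decide
  have m2 : Prism.Adj (1, 0) (1, 1) := by rw [prism_adj]; decide
  have m3 : Prism.Adj (2, 0) (2, 1) := by rw [prism_adj]; decide
  -- all information at a vertex with neighbours `v`, `w` (same triangle) and `z`
  have loc3 := fun {u v w z : Fin 3 × Fin 2} (hv : Prism.Adj u v) (hw : Prism.Adj u w)
      (hz : Prism.Adj u z) (a : v ≠ w) (b : v ≠ z) (c : w ≠ z) =>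
    And.intro (loc hv hw hz a b c) (And.intro (loc hw hz hv c a.symm b.symm)
      (loc hz hv hw b.symm c.symm a))
  have l1 := loc3 t12 t13 m1 (by decide) (by decide) (by decide)
  have l2 := loc3 t12.symm t23 m2 (by decide) (by decide) (by decide)
  have l3 := loc3 t13.symm t23.symm m3 (by decide) (by decide) (by decide)
  have k1 := loc3 s12 s13 m1.symm (by decide) (by decide) (by decide)
  have k2 := loc3 s12.symm s23 m2.symm (by decide) (by decide) (by decide)
  have k3 := loc3 s13.symm s23.symm m3.symm (by decide) (by decide) (by decide)
  clear loc3 loc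
  generalize C (mkVert Prism 5 t12 1 _) = a12 at *
  generalize C (mkVert Prism 5 t12.symm 1 _) = a21 at *
  generalize C (mkVert Prism 5 t13 1 _) = a13 at *
  generalize C (mkVert Prism 5 t13.symm 1 _) = a31 at *
  generalize C (mkVert Prism 5 t23 1 _) = a23 at *
  generalize C (mkVert Prism 5 t23.symm 1 _) = a32 at *
  generalize C (mkVert Prism 5 s12 1 _) = g12 at *
  generalize C (mkVert Prism 5 s12.symm 1 _) = g21 at *
  generalize C (mkVert Prism 5 s13 1 _) = g13 at *
  generalize C (mkVert Prism 5 s13.symm 1 _) = g31 at *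
  generalize C (mkVert Prism 5 s23 1 _) = g23 at *
  generalize C (mkVert Prism 5 s23.symm 1 _) = g32 at *
  generalize C (mkVert Prism 5 m1 1 _) = b1 at *
  generalize C (mkVert Prism 5 m1.symm 1 _) = c1 at *
  generalize C (mkVert Prism 5 m2 1 _) = b2 at *
  generalize C (mkVert Prism 5 m2.symm 1 _) = c2 at *
  generalize C (mkVert Prism 5 m3 1 _) = b3 at *
  generalize C (mkVert Prism 5 m3.symm 1 _) = c3 at *
  generalize C (mkVert Prism 5 t12 2 _) = d12 at *
  generalize C (mkVert Prism 5 t12.symm 2 _) = d21 at *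
  generalize C (mkVert Prism 5 t13 2 _) = d13 at *
  generalize C (mkVert Prism 5 t13.symm 2 _) = d31 at *
  generalize C (mkVert Prism 5 t23 2 _) = d23 at *
  generalize C (mkVert Prism 5 t23.symm 2 _) = d32 at *
  generalize C (mkVert Prism 5 s12 2 _) = x12 at *
  generalize C (mkVert Prism 5 s12.symm 2 _) = x21 at *
  generalize C (mkVert Prism 5 s13 2 _) = x13 at *
  generalize C (mkVert Prism 5 s13.symm 2 _) = x31 at *
  generalize C (mkVert Prism 5 s23 2 _) = x23 at *
  generalize C (mkVert Prism 5 s23.symm 2 _) = x32 at *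
  generalize C (mkVert Prism 5 m1 2 _) = d1 at *
  generalize C (mkVert Prism 5 m1.symm 2 _) = x1 at *
  generalize C (mkVert Prism 5 m2 2 _) = d2 at *
  generalize C (mkVert Prism 5 m2.symm 2 _) = x2 at *
  generalize C (mkVert Prism 5 m3 2 _) = d3 at *
  generalize C (mkVert Prism 5 m3.symm 2 _) = x3 at *
  clear C t12 t13 t23 s12 s13 s23 m1 m2 m3
  obtain ⟨⟨rfl, l11, l12, l13, l14⟩, ⟨rfl, l15, l16, l17, l18⟩, ⟨-, l19, l10, l1a, l1b⟩⟩ := l1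
  obtain ⟨⟨rfl, l21, l22, l23, l24⟩, ⟨rfl, l25, l26, l27, l28⟩, ⟨-, l29, l20, l2a, l2b⟩⟩ := l2
  obtain ⟨⟨rfl, l31, l32, l33, l34⟩, ⟨rfl, l35, l36, l37, l38⟩, ⟨-, l39, l30, l3a, l3b⟩⟩ := l3
  obtain ⟨⟨rfl, k11, k12, k13, k14⟩, ⟨rfl, k15, k16, k17, k18⟩, ⟨-, k19, k10, k1a, k1b⟩⟩ := k1
  obtain ⟨⟨rfl, k21, k22, k23, k24⟩, ⟨rfl, k25, k26, k27, k28⟩, ⟨-, k29, k20, k2a, k2b⟩⟩ := k2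
  obtain ⟨⟨rfl, k31, k32, k33, k34⟩, ⟨rfl, k35, k36, k37, k38⟩, ⟨-, k39, k30, k3a, k3b⟩⟩ := k3
  have T := triangle_lemma d12 d21 d31 x12 x21 x31 a12 a13 a21 a23 a31 a32 b1 b2 b3
    l13 l17 l27 l14 l18.symm l1b l24 l28.symm l2b l34 l38.symm l3b l12 l16 l26
    l11 l19.symm l15 l21 l29.symm l25 l31 l39.symm l35 l1a l2a l3a
  have S := triangle_lemma x12 x21 x31 d12 d21 d31 g12 g13 g21 g23 g31 g32 c1 c2 c3
    k13 k17 k27 k14 k18.symm k1b k24 k28.symm k2b k34 k38.symm k3b k12 k16 k26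
    k11 k19.symm k15 k21 k29.symm k25 k31 k39.symm k35 k1a k2a k3a
  exact prism_lemma _ _ _ _ _ _ _ _ _ _ _ _ l13 l17 l27 k13 k17 k27 l1a l2a l3a
    l10 l20 l30 T S

theorem triangular_prism_counterexample :
    (fracPower (SimpleGraph.cycleGraph 3 □ (⊤ : SimpleGraph (Fin 2))) 3 5).cliqueNum = 5 ∧
    6 ≤ (fracPower (SimpleGraph.cycleGraph 3 □ (⊤ : SimpleGraph (Fin 2))) 3 5).chromaticNumber ∧
    ((fracPower (SimpleGraph.cycleGraph 3 □ (⊤ : SimpleGraph (Fin 2))) 3 5).cliqueNum : ℕ∞) <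
      (fracPower (SimpleGraph.cycleGraph 3 □ (⊤ : SimpleGraph (Fin 2))) 3 5).chromaticNumber := by
  have hfin : Finite (SubdivVert Prism 5) :=
    Finite.of_injective (fun x => (⟨enc x, enc_lt x⟩ : Fin 42)) fun x y h =>
      enc_injective (congrArg Fin.val h)
  have hω : (fracPower Prism 3 5).cliqueNum = 5 := by
    apply le_antisymm
    · obtain ⟨s, hs⟩ := (fracPower Prism 3 5).exists_isNClique_cliqueNum
      rw [← hs.card_eq]
      exact clique_le hs.isClique
    · obtain ⟨s, hs⟩ := exists_clique
      refine hs.card_eq.symm.le.trans ?_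
      exact hs.isClique.card_le_cliqueNum
  have hχ : 6 ≤ (fracPower Prism 3 5).chromaticNumber := by
    by_contra hlt
    rw [not_le] at hlt
    apply not_colorable
    rw [← chromaticNumber_le_iff_colorable]
    exact Order.le_of_lt_add_one (lt_of_lt_of_eq hlt (by norm_num))
  refine ⟨hω, hχ, ?_⟩
  change ((fracPower Prism 3 5).cliqueNum : ℕ∞) < _
  rw [hω]
  exact lt_of_lt_of_le (by norm_num) hχ
end
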